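/- arXiv:2106.09796 — 2 statements merged into one kernel-verified Lean document; each statement's English description precedes it below -/
import Mathlib

section
/- Let A be a commutative Noetherian ring, let I be an ideal of A, and let M be a finitely generated A-module. Then H^j_I(M) = 0 for every integer j strictly greater than the Krull dimension of M. In particular, lcd_A(I) ≤ dim A for every ideal I. -/
open CategoryTheory

section Comparison

variable {C : Type*} [Category* C] [Abelian C] [EnoughProjectives C] {R : Type*} [Ring R]
  [Linear R C]

/-- A degree `p + 1` class of the derived functor `Ext` is represented by a class of `Abelian.Ext`
which detects the vanishing of its pullbacks. -/
lemma exists_abelianExt_map_eq_zero [HasExt C] {X Y : C} {p : ℕ}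
    (x : ((Ext R C (p + 1)).obj (Opposite.op X)).obj Y) :
    ∃ ξ : Abelian.Ext X Y (p + 1), ∀ {X' : C} (g : X' ⟶ X),
      (Abelian.Ext.mk₀ g).comp ξ (zero_add _) = 0 →
        (((Ext R C (p + 1)).map g.op).app Y) x = 0 := by
  let P := projectiveResolution X
  let F := ((linearYoneda R C).obj Y).rightOp
  let K := (F.mapHomologicalComplex (ComplexShape.down ℕ)).obj P.complex
  let n := p + 1
  let e : (F.leftDerived n).obj X ≅ K.homology n := P.isoLeftDerivedObj F n
  have surj : Function.Surjective (e.hom ≫ K.homologyι n).unop :=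
    (ModuleCat.epi_iff_surjective _).mp (unop_epi_of_mono _)
  obtain ⟨z, rfl⟩ := surj x
  let f : P.complex.X n ⟶ Y := (K.pOpcycles n).unop z
  have hf : P.complex.d (n + 1) n ≫ f = 0 := by
    have := congr(($(K.d_pOpcycles (n + 1) n)).unop z)
    exact this
  refine ⟨P.extMk f (n + 1) rfl hf, fun {X'} g hg ↦ ?_⟩
  let P' := projectiveResolution X'
  let K' := (F.mapHomologicalComplex (ComplexShape.down ℕ)).obj P'.complex
  let e' : (F.leftDerived n).obj X' ≅ K'.homology n := P'.isoLeftDerivedObj F n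
  let φ : ProjectiveResolution.Hom P' P g :=
    { hom := ProjectiveResolution.lift g P' P
      hom_f_zero_comp_π_f_zero := by
        simpa using ProjectiveResolution.lift_commutes_zero g P' P }
  rw [P.mk₀_comp_extMk f (n + 1) rfl hf φ,
    ProjectiveResolution.extMk_eq_zero_iff _ _ _ _ _ p rfl] at hg
  obtain ⟨h, hh⟩ := hg
  let Φ : K' ⟶ K := (F.mapHomologicalComplex (ComplexShape.down ℕ)).map φ.hom
  have inj : Function.Injective (K'.pOpcycles n).unop :=
    (ModuleCat.mono_iff_injective _).mp inferInstance
  have hz : (HomologicalComplex.opcyclesMap Φ n).unop z = (K'.fromOpcycles n p).unop h := by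
    apply inj
    have h₁ := congr(($(HomologicalComplex.p_opcyclesMap Φ n)).unop z)
    have h₂ := congr(($(K'.p_fromOpcycles n p)).unop h)
    exact (h₁.trans hh.symm).trans h₂.symm
  have nat : (F.leftDerived n).map g ≫ e.hom = e'.hom ≫ HomologicalComplex.homologyMap Φ n :=
    P'.isoLeftDerivedObj_hom_naturality g P φ.hom
      (ProjectiveResolution.lift_commutes_zero g P' P) F n
  have key : (F.leftDerived n).map g ≫ e.hom ≫ K.homologyι n =
      e'.hom ≫ K'.homologyι n ≫ HomologicalComplex.opcyclesMap Φ n := by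
    rw [reassoc_of% nat, HomologicalComplex.homologyι_naturality]
  have h₁ := congr(($key).unop z)
  have h₂ := congr(e'.hom.unop ((K'.homologyι n).unop $hz))
  have h₃ := congr(e'.hom.unop
    (($(K'.homologyι_comp_fromOpcycles n p)).unop h))
  exact (h₁.trans h₂).trans (h₃.trans (map_zero _))

lemma isZero_Ext_of_isZero (X : C) {Y : C} (hY : Limits.IsZero Y) (n : ℕ) :
    Limits.IsZero (((Ext R C n).obj (Opposite.op X)).obj Y) := by
  refine .of_iso ?_ ((projectiveResolution X).isoExt n Y)
  rw [← HomologicalComplex.exactAt_iff_isZero_homology, HomologicalComplex.exactAt_iff]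
  refine ShortComplex.exact_of_isZero_X₂ _ ?_
  rw [Limits.IsZero.iff_id_eq_zero]
  ext (x : _ ⟶ _)
  exact hY.eq_of_tgt _ _

end Comparison

section LocalCohomology

variable {A : Type} [CommRing A]

/-- The projection `A ⧸ I ^ t ⟶ A ⧸ I ^ s` for `s ≤ t`. -/
abbrev Ideal.powQuotientHom (I : Ideal A) {s t : ℕ} (h : s ≤ t) :
    ModuleCat.of A (A ⧸ I ^ t) ⟶ ModuleCat.of A (A ⧸ I ^ s) :=
  ModuleCat.ofHom (Submodule.mapQ _ _ LinearMap.id (Ideal.pow_le_pow_right h))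

lemma localCohomology.subsingleton_obj {I : Ideal A} {j : ℕ} {N : ModuleCat A}
    (H : ∀ (s : ℕ) (x : ((Ext A (ModuleCat A) j).obj (.op (ModuleCat.of A (A ⧸ I ^ s)))).obj N),
      ∃ (t : ℕ) (h : s ≤ t), ((Ext A (ModuleCat A) j).map (I.powQuotientHom h).op).app N x = 0) :
    Subsingleton ((localCohomology I j).obj N) := by
  refine subsingleton_of_forall_eq 0 fun y ↦ ?_
  let D := diagram (idealPowersDiagram I) j
  have : Limits.HasColimit D := hasColimitDiagram (idealPowersDiagram I) j
  have hc := Limits.isColimitOfPreserves ((evaluation _ _).obj N) (Limits.colimit.isColimit D)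
  obtain ⟨s, x, rfl⟩ := Limits.Concrete.isColimit_exists_rep _ hc y
  obtain ⟨t, h, hx⟩ := H s.unop.unop x
  let e : s ⟶ .op (.op t) := (homOfLE h).op.op
  have hw := congr(($((((evaluation _ _).obj N).mapCocone (Limits.colimit.cocone D)).w e)) x)
  refine hw.symm.trans ?_
  have hx' : ((D ⋙ (evaluation _ _).obj N).map e) x = 0 := hx
  rw [ConcreteCategory.comp_apply, hx', map_zero]
  rfl

/-- Every class in `Ext^j(A ⧸ I ^ s, N)` dies in `Ext^j(A ⧸ I ^ t, N)` for some `t ≥ s`, i.e. the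
colimit of these groups along the projections vanishes. -/
def Ideal.ColimExtVanishes (I : Ideal A) (j : ℕ) (N : ModuleCat A) : Prop :=
  ∀ (s : ℕ) (ξ : Abelian.Ext (ModuleCat.of A (A ⧸ I ^ s)) N j),
    ∃ (t : ℕ) (h : s ≤ t), (Abelian.Ext.mk₀ (I.powQuotientHom h)).comp ξ (zero_add j) = 0

/-- Every element of `N` is killed by some power of `I`. -/
def Ideal.IsPowTorsion (I : Ideal A) (N : Type) [AddCommGroup N] [Module A N] : Prop :=
  ∀ x : N, ∃ k : ℕ, ∀ a ∈ I ^ k, a • x = 0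

open Abelian in
lemma Ideal.mk₀_powQuotientHom_comp (I : Ideal A) {N : ModuleCat A} {j r s t : ℕ} (hrs : r ≤ s)
    (hst : s ≤ t) (ξ : Ext (ModuleCat.of A (A ⧸ I ^ r)) N j) :
    (Ext.mk₀ (I.powQuotientHom (hrs.trans hst))).comp ξ (zero_add j) =
      (Ext.mk₀ (I.powQuotientHom hst)).comp
        ((Ext.mk₀ (I.powQuotientHom hrs)).comp ξ (zero_add j)) (zero_add j) := by
  have : I.powQuotientHom (hrs.trans hst) = I.powQuotientHom hst ≫ I.powQuotientHom hrs := by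
    ext; rfl
  rw [Ext.mk₀_comp_mk₀_assoc, this]

namespace Ideal.ColimExtVanishes

open Abelian

variable {I : Ideal A} {S : ShortComplex (ModuleCat A)} {j : ℕ}

lemma of_shortExact (hS : S.ShortExact) (h₁ : I.ColimExtVanishes j S.X₁)
    (h₃ : I.ColimExtVanishes j S.X₃) : I.ColimExtVanishes j S.X₂ := by
  intro r ξ
  obtain ⟨s, hrs, hs⟩ := h₃ r (ξ.comp (.mk₀ S.g) (add_zero j))
  rw [← Ext.comp_assoc _ _ _ (zero_add j) (add_zero j) (by simp)] at hs
  obtain ⟨η, hη⟩ := Ext.covariant_sequence_exact₂ _ hS _ hs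
  obtain ⟨t, hst, ht⟩ := h₁ s η
  refine ⟨t, hrs.trans hst, ?_⟩
  rw [I.mk₀_powQuotientHom_comp hrs hst, ← hη,
    ← Ext.comp_assoc _ _ _ (zero_add j) (add_zero j) (by simp), ht, Ext.zero_comp]

/-- A class coming from `Ext^j(-, S.X₃)` along the connecting map dies. -/
lemma exists_comp_extClass_eq_zero (hS : S.ShortExact) (h₃ : I.ColimExtVanishes j S.X₃) {r : ℕ}
    (η : Ext (ModuleCat.of A (A ⧸ I ^ r)) S.X₃ j) : ∃ (t : ℕ) (h : r ≤ t),
      (Ext.mk₀ (I.powQuotientHom h)).comp (η.comp hS.extClass rfl) (zero_add (j + 1)) = 0 := by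
  obtain ⟨t, h, ht⟩ := h₃ r η
  refine ⟨t, h, ?_⟩
  rw [← Ext.comp_assoc _ _ _ (zero_add j) rfl (by simp), ht, Ext.zero_comp]

lemma succ_of_injective (hS : S.ShortExact) [Injective S.X₂]
    (h₃ : I.ColimExtVanishes j S.X₃) : I.ColimExtVanishes (j + 1) S.X₁ := by
  intro r ξ
  obtain ⟨η, rfl⟩ := Ext.covariant_sequence_exact₁ _ hS ξ (Ext.eq_zero_of_injective _) rfl
  exact exists_comp_extClass_eq_zero hS h₃ η

lemma succ_of_isSMulRegular {N : ModuleCat A} {x : A} (hxI : x ∈ I) (hx : IsSMulRegular N x)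
    (H : ∀ s : ℕ, I.ColimExtVanishes j (N.smulShortComplex (x ^ s)).X₃) :
    I.ColimExtVanishes (j + 1) N := by
  intro s ξ
  have hS := (hx.pow s).smulShortComplex_shortExact
  have h0 : x ^ s • 𝟙 (ModuleCat.of A (A ⧸ I ^ s)) = 0 := by
    ext
    change Submodule.Quotient.mk (x ^ s • (1 : A)) = (0 : A ⧸ I ^ s)
    rw [Submodule.Quotient.mk_eq_zero, smul_eq_mul, mul_one]
    exact Ideal.pow_mem_pow hxI s
  have hξ : ξ.comp (.mk₀ (N.smulShortComplex (x ^ s)).f) (add_zero (j + 1)) = 0 := by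
    rw [ModuleCat.smulShortComplex_f_eq_smul_id]
    refine (Ext.smul_eq_comp_mk₀ ξ (x ^ s)).symm.trans ?_
    rw [← Ext.mk₀_id_comp ξ, ← Ext.smul_comp, ← Ext.mk₀_smul, h0, Ext.mk₀_zero, Ext.zero_comp]
    rfl
  obtain ⟨η, rfl⟩ := Ext.covariant_sequence_exact₁ _ hS ξ hξ rfl
  exact exists_comp_extClass_eq_zero hS (H s) η

end Ideal.ColimExtVanishes

namespace Ideal

variable (I : Ideal A)

/-- The submodule of elements killed by some power of `I`. -/
def powTorsion (E : Type) [AddCommGroup E] [Module A E] : Submodule A E where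
  carrier := {x | ∃ k : ℕ, ∀ a ∈ I ^ k, a • x = 0}
  zero_mem' := ⟨0, fun _ _ ↦ smul_zero _⟩
  add_mem' := by
    rintro x y ⟨k, hk⟩ ⟨l, hl⟩
    refine ⟨k + l, fun a ha ↦ ?_⟩
    rw [smul_add, hk a (Ideal.pow_le_pow_right (Nat.le_add_right k l) ha),
      hl a (Ideal.pow_le_pow_right (Nat.le_add_left l k) ha), add_zero]
  smul_mem' := by
    rintro c x ⟨k, hk⟩
    exact ⟨k, fun a ha ↦ by rw [smul_comm, hk a ha, smul_zero]⟩

variable {I}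

lemma isPowTorsion_powTorsion (E : Type) [AddCommGroup E] [Module A E] :
    I.IsPowTorsion (I.powTorsion E) := by
  rintro ⟨x, k, hk⟩
  exact ⟨k, fun a ha ↦ Subtype.ext (hk a ha)⟩

lemma IsPowTorsion.of_surjective {N P : Type} [AddCommGroup N] [Module A N] [AddCommGroup P]
    [Module A P] (hN : I.IsPowTorsion N) (f : N →ₗ[A] P) (hf : Function.Surjective f) :
    I.IsPowTorsion P := by
  intro y
  obtain ⟨x, rfl⟩ := hf y
  obtain ⟨k, hk⟩ := hN x
  exact ⟨k, fun a ha ↦ by rw [← map_smul, hk a ha, map_zero]⟩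

lemma IsPowTorsion.exists_pow_smul_eq_zero {N P : Type} [AddCommGroup N] [Module A N]
    [AddCommGroup P] [Module A P] [Module.Finite A P] (hN : I.IsPowTorsion N) (g : P →ₗ[A] N) :
    ∃ k : ℕ, ∀ a ∈ I ^ k, ∀ y : P, a • g y = 0 := by
  obtain ⟨s, hs⟩ := Module.Finite.fg_top (R := A) (M := P)
  choose k hk using fun y : P ↦ hN (g y)
  refine ⟨s.sup k, fun a ha y ↦ ?_⟩
  have hy : y ∈ Submodule.span A (s : Set P) := hs ▸ Submodule.mem_top
  induction hy using Submodule.span_induction with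
  | mem y hy => exact hk y a (Ideal.pow_le_pow_right (Finset.le_sup hy) ha)
  | zero => simp
  | add y z _ _ hy hz => rw [map_add, smul_add, hy, hz, add_zero]
  | smul c y _ hy => rw [map_smul, smul_comm, hy, smul_zero]

instance [IsNoetherianRing A] (E : Type) [AddCommGroup E] [Module A E] [Module.Injective A E] :
    Module.Injective A (I.powTorsion E) := by
  refine Module.Baer.injective fun J g ↦ ?_
  obtain ⟨k, hk⟩ := (isPowTorsion_powTorsion E).exists_pow_smul_eq_zero g
  obtain ⟨l, hl⟩ := I.exists_pow_inf_eq_pow_smul J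
  let n := l + k
  let f : J →ₗ[A] A ⧸ I ^ n := (I ^ n).mkQ ∘ₗ J.subtype
  have hfg : LinearMap.ker f ≤ LinearMap.ker ((I.powTorsion E).subtype ∘ₗ g) := by
    rintro ⟨y, hyJ⟩ hy
    have hyI : y ∈ I ^ n := (Submodule.Quotient.mk_eq_zero _).mp hy
    have hy' : y ∈ I ^ k • J := by
      have h := (hl n (Nat.le_add_right l k)).le ⟨by simpa using hyI, hyJ⟩
      rw [Nat.add_sub_cancel_left] at h
      exact (smul_mono_right (I ^ k) inf_le_right : _ ≤ I ^ k • J) h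
    have key : I ^ k • J ≤ (LinearMap.ker g).map J.subtype := by
      refine Submodule.smul_le.mpr fun a ha b hb ↦ ⟨a • ⟨b, hb⟩, ?_, rfl⟩
      exact (map_smul g a _).trans (hk a ha ⟨b, hb⟩)
    obtain ⟨w, hw, hwy⟩ := key hy'
    obtain rfl : w = ⟨y, hyJ⟩ := Subtype.ext hwy
    exact congrArg Subtype.val hw
  obtain ⟨h, hh⟩ := Module.Injective.out (R := A) (Q := E) ((LinearMap.ker f).liftQ f le_rfl)
    (LinearMap.ker_eq_bot.mp (Submodule.ker_liftQ_eq_bot _ _ _ le_rfl))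
    ((LinearMap.ker f).liftQ _ hfg)
  refine ⟨(h ∘ₗ (I ^ n).mkQ).codRestrict _ fun a ↦ ⟨n, fun b hb ↦ ?_⟩, fun x hx ↦ ?_⟩
  · have : (I ^ n).mkQ (b • a) = 0 :=
      (Submodule.Quotient.mk_eq_zero _).mpr (Ideal.mul_mem_right a _ hb)
    rw [LinearMap.comp_apply, ← map_smul, ← map_smul, this, map_zero]
  · exact Subtype.ext (hh (Submodule.Quotient.mk ⟨x, hx⟩))

/-- A power torsion module embeds in an injective power torsion module. -/
lemma IsPowTorsion.exists_shortExact [IsNoetherianRing A] {N : ModuleCat A}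
    (hN : I.IsPowTorsion N) :
    ∃ (G Q : ModuleCat A) (f : N ⟶ G) (g : G ⟶ Q) (w : f ≫ g = 0),
      (ShortComplex.mk f g w).ShortExact ∧ Injective G ∧ I.IsPowTorsion G ∧ I.IsPowTorsion Q := by
  let E := Injective.under N
  have hE : Module.Injective A E :=
    Module.injective_module_of_injective_object A E (inj := inferInstanceAs (Injective E))
  have hι : Function.Injective (Injective.ι N) := (ModuleCat.mono_iff_injective _).mp inferInstance
  let f : N →ₗ[A] I.powTorsion E := (Injective.ι N).hom.codRestrict _ fun x ↦ by
    obtain ⟨k, hk⟩ := hN x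
    exact ⟨k, fun a ha ↦ by rw [← map_smul, hk a ha, map_zero]⟩
  refine ⟨.of A (I.powTorsion E), .of A (I.powTorsion E ⧸ LinearMap.range f), ModuleCat.ofHom f,
    ModuleCat.ofHom (LinearMap.range f).mkQ, ?_, ?_, ?_, ?_, ?_⟩
  · ext x
    exact (Submodule.Quotient.mk_eq_zero _).mpr ⟨x, rfl⟩
  · refine ModuleCat.shortComplex_shortExact _ (LinearMap.exact_map_mkQ_range f) (fun x y h ↦ ?_)
      (Submodule.mkQ_surjective _)
    exact hι congr(($h).1)
  · exact Module.injective_object_of_injective_module A _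
  · exact isPowTorsion_powTorsion E
  · exact (isPowTorsion_powTorsion E).of_surjective _ (Submodule.mkQ_surjective _)

open Abelian in
lemma IsPowTorsion.colimExtVanishes_one {S : ShortComplex (ModuleCat A)} (hS : S.ShortExact)
    [Injective S.X₂] (hT : I.IsPowTorsion S.X₂) : I.ColimExtVanishes 1 S.X₁ := by
  intro r ξ
  obtain ⟨η, rfl⟩ := Ext.covariant_sequence_exact₁ _ hS ξ (Ext.eq_zero_of_injective _) rfl
  obtain ⟨f, rfl⟩ := (Ext.mk₀_bijective _ _).2 η
  have := hS.epi_g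
  obtain ⟨e, he⟩ := (ModuleCat.epi_iff_surjective S.g).mp inferInstance
    (f (Submodule.Quotient.mk 1))
  obtain ⟨k, hk⟩ := hT e
  refine ⟨r + k, Nat.le_add_right r k, ?_⟩
  let φ : ModuleCat.of A (A ⧸ I ^ (r + k)) ⟶ S.X₂ :=
    ModuleCat.ofHom ((I ^ (r + k)).liftQ (LinearMap.toSpanSingleton A S.X₂ e)
      fun a ha ↦ hk a (Ideal.pow_le_pow_right (Nat.le_add_left k r) ha))
  have hφ : I.powQuotientHom (Nat.le_add_right r k) ≫ f = φ ≫ S.g := by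
    ext
    change f (Submodule.Quotient.mk 1) = S.g ((1 : A) • e)
    rw [one_smul, he]
  rw [Ext.mk₀_comp_mk₀_assoc, hφ, ← Ext.mk₀_comp_mk₀_assoc, hS.comp_extClass, Ext.comp_zero]

lemma IsPowTorsion.colimExtVanishes [IsNoetherianRing A] (j : ℕ) {N : ModuleCat A}
    (hN : I.IsPowTorsion N) : I.ColimExtVanishes (j + 1) N := by
  obtain ⟨G, Q, f, g, w, hS, _, hG, hQ⟩ := hN.exists_shortExact
  induction j generalizing N G Q with
  | zero => exact colimExtVanishes_one (S := .mk f g w) hS hG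
  | succ j ih =>
    obtain ⟨G', Q', f', g', w', hS', hG'', hG', hQ'⟩ := hQ.exists_shortExact
    exact .succ_of_injective (S := .mk f g w) hS (ih hQ G' Q' f' g' w' hS' hG'' hG' hQ')

end Ideal

lemma Ideal.colimExtVanishes_of_subsingleton (I : Ideal A) (j : ℕ) (N : ModuleCat A)
    [Subsingleton N] : I.ColimExtVanishes j N := fun s ξ ↦ ⟨s, le_rfl, by
  rw [← Abelian.Ext.comp_mk₀_id ξ, (ModuleCat.isZero_of_subsingleton N).eq_of_src (𝟙 N) 0,
    Abelian.Ext.mk₀_zero, Abelian.Ext.comp_zero, Abelian.Ext.comp_zero]⟩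

lemma Module.subsingleton_of_supportDim_lt_zero {N : Type*} [AddCommGroup N] [Module A N]
    (h : Module.supportDim A N < 0) : Subsingleton N := by
  by_contra! hN
  have := (Module.nonempty_support_of_nontrivial (R := A) (M := N)).to_subtype
  exact h.not_ge Order.krullDim_nonneg

open Module in
lemma Ideal.colimExtVanishes_of_supportDim_lt [IsNoetherianRing A] (I : Ideal A) (j : ℕ)
    (N : Type) [AddCommGroup N] [Module A N] [Module.Finite A N] (h : supportDim A N < j) :
    I.ColimExtVanishes j (.of A N) := by
  induction j generalizing N with
  | zero =>
    have : Subsingleton N := subsingleton_of_supportDim_lt_zero (mod_cast h)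
    exact I.colimExtVanishes_of_subsingleton 0 _
  | succ j ih =>
    induction ‹Module.Finite A N› using
      IsNoetherianRing.induction_on_isQuotientEquivQuotientPrime A with
    | subsingleton N => exact I.colimExtVanishes_of_subsingleton _ _
    | quotient N p e =>
      by_cases hI : I ≤ p.1
      · refine IsPowTorsion.colimExtVanishes j fun x ↦ ⟨1, fun a ha ↦ e.injective ?_⟩
        obtain ⟨y, hy⟩ := Submodule.Quotient.mk_surjective _ (e x)
        rw [map_smul, map_zero, ← hy, ← Submodule.Quotient.mk_smul, Submodule.Quotient.mk_eq_zero]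
        exact Ideal.mul_mem_right y _ (hI (pow_one I ▸ ha))
      · obtain ⟨x, hxI, hxp⟩ := SetLike.not_le_iff_exists.mp hI
        have hx : IsSMulRegular N x := by
          refine (e.isSMulRegular_congr x).mpr fun y z hyz ↦ ?_
          obtain ⟨y, rfl⟩ := Ideal.Quotient.mk_surjective y
          obtain ⟨z, rfl⟩ := Ideal.Quotient.mk_surjective z
          have h : x * y - x * z ∈ p.1 := Ideal.Quotient.eq.mp hyz
          rw [← mul_sub] at h
          exact Ideal.Quotient.eq.mpr ((p.2.mem_or_mem h).resolve_left hxp)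
        refine .succ_of_isSMulRegular (N := .of A N) hxI hx fun s ↦ ?_
        refine ih (QuotSMulTop (x ^ s) N) ?_
        have := supportDim_quotSMulTop_succ_le_of_notMem_minimalPrimes
          fun _ ↦ (hx.pow s).notMem_of_mem_minimalPrimes
        have := this.trans_lt h
        push_cast at this
        exact lt_of_add_lt_add_right this
    | exact N₁ N₂ N₃ f g hf hg hfg h₁ h₃ =>
      have hS := ModuleCat.shortComplex_shortExact
        (ModuleCat.shortComplexOfCompEqZero f g hfg.linearMap_comp_eq_zero) hfg hf hg
      exact .of_shortExact hS (h₁ ((supportDim_le_of_injective f hf).trans_lt h))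
        (h₃ ((supportDim_le_of_surjective g hg).trans_lt h))

lemma localCohomology.subsingleton_of_supportDim_lt [IsNoetherianRing A] (I : Ideal A) (M : Type)
    [AddCommGroup M] [Module A M] [Module.Finite A M] {j : ℕ}
    (h : Module.supportDim A M < j) :
    Subsingleton ((localCohomology I j).obj (ModuleCat.of A M)) := by
  refine localCohomology.subsingleton_obj fun s x ↦ ?_
  cases j with
  | zero =>
    have : Subsingleton M := Module.subsingleton_of_supportDim_lt_zero (mod_cast h)
    have := ModuleCat.subsingleton_of_isZero
      (isZero_Ext_of_isZero (R := A) (ModuleCat.of A (A ⧸ I ^ s))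
        (ModuleCat.isZero_of_subsingleton (ModuleCat.of A M)) 0)
    exact ⟨s, le_rfl, by rw [Subsingleton.elim x 0, map_zero]⟩
  | succ p =>
    obtain ⟨ξ, hξ⟩ := exists_abelianExt_map_eq_zero x
    obtain ⟨t, hst, ht⟩ := I.colimExtVanishes_of_supportDim_lt (p + 1) M h s ξ
    exact ⟨t, hst, hξ _ ht⟩

end LocalCohomology

/-- **Grothendieck vanishing.** For a commutative Noetherian ring `A`, an ideal `I` and a
finitely generated `A`-module `M`, the local cohomology `H^j_I(M)` vanishes for every
`j > dim M` (Krull dimension of `A ⧸ Ann M`); in particular `lcd_A(I) ≤ dim A` for every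
ideal of `A`. -/
theorem grothendieck_vanishing
    (A : Type) [CommRing A] [IsNoetherianRing A]
    (I : Ideal A) (M : Type) [AddCommGroup M] [Module A M] [Module.Finite A M] :
    (∀ j : ℕ, ringKrullDim (A ⧸ Module.annihilator A M) < (j : WithBot ℕ∞) →
        Subsingleton ((localCohomology I j).obj (ModuleCat.of A M))) ∧
      (∀ (J : Ideal A) (k : ℕ), ringKrullDim A < (k : WithBot ℕ∞) →
        Subsingleton ((localCohomology J k).obj (ModuleCat.of A A))) := by
  refine ⟨fun j hj ↦ ?_, fun J k hk ↦ ?_⟩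
  · exact localCohomology.subsingleton_of_supportDim_lt I M
      (Module.supportDim_eq_ringKrullDim_quotient_annihilator A M ▸ hj)
  · exact localCohomology.subsingleton_of_supportDim_lt J A
      (Module.supportDim_self_eq_ringKrullDim A ▸ hk)
end

section
/- Let (A,m) be a commutative Noetherian local ring and let M be a nonzero finitely generated A-module. Then H^{dim M}_m(M) ≠ 0. Moreover, if dim M > 0, then H^{dim M}_m(M) is not a finitely generated A-module. -/
open CategoryTheory

universe w v u t

lemma HomologicalComplex.homologyUnop_inv_naturality {ι V : Type*} [Category V]
    [Limits.HasZeroMorphisms V] {c : ComplexShape ι} {K L : HomologicalComplex Vᵒᵖ c}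
    (φ : K ⟶ L) (i : ι) [K.HasHomology i] [L.HasHomology i] :
    (homologyMap φ i).unop ≫ (homologyUnop K i).inv =
      (homologyUnop L i).inv ≫ homologyMap ((unopFunctor _ _).map φ.op) i := by
  have h : homologyMap ((unopFunctor _ _).map φ.op) i ≫ (homologyUnop K i).hom =
      (homologyUnop L i).hom ≫ (homologyMap φ i).unop :=
    (congrArg Quiver.Hom.unop
      (homologyOp_hom_naturality (φ := (unopFunctor _ _).map φ.op) (i := i))).symm
  have aux {a b c d : V} (f : a ⟶ b) (g : c ⟶ d) (e₁ : a ≅ c) (e₂ : b ≅ d)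
      (h : f ≫ e₂.hom = e₁.hom ≫ g) : g ≫ e₂.inv = e₁.inv ≫ f := by
    rw [Iso.comp_inv_eq, Category.assoc, h, Iso.inv_hom_id_assoc]
  exact aux _ _ _ _ h

namespace CategoryTheory.ProjectiveResolution

section
variable {R : Type t} [Ring R] {C : Type u} [Category.{v} C] [Abelian C] [Linear R C]

variable (R) in
/-- A lift of `f : X' ⟶ X` to projective resolutions, applied to `Hom(-, Y)`. -/
noncomputable def linearYonedaMap {X X' : C} {P : ProjectiveResolution X}
    {P' : ProjectiveResolution X'} {f : X' ⟶ X} (φ : Hom P' P f) (Y : C) :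
    P.complex.linearYonedaObj R Y ⟶ P'.complex.linearYonedaObj R Y :=
  (HomologicalComplex.unopFunctor _ _).map
    (((((linearYoneda R C).obj Y).rightOp.mapHomologicalComplex _).map φ.hom).op)

lemma isoExt_hom_naturality [EnoughProjectives C] {X X' : C} {P : ProjectiveResolution X}
    {P' : ProjectiveResolution X'} {f : X' ⟶ X} (φ : Hom P' P f) (Y : C) (n : ℕ) :
    ((Ext R C n).map f.op).app Y ≫ (P'.isoExt n Y).hom =
      (P.isoExt n Y).hom ≫ HomologicalComplex.homologyMap (linearYonedaMap R φ Y) n := by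
  have h := congrArg Quiver.Hom.unop (P'.isoLeftDerivedObj_inv_naturality f P φ.hom
    (by simpa using φ.hom_f_zero_comp_π_f_zero) ((linearYoneda R C).obj Y).rightOp n)
  have h₂ := HomologicalComplex.homologyUnop_inv_naturality
    ((((linearYoneda R C).obj Y).rightOp.mapHomologicalComplex _).map φ.hom) n
  dsimp only [isoExt, Iso.trans_hom, Iso.symm_hom, Iso.unop_inv, linearYonedaMap]
  refine Eq.trans ?_ (Eq.trans (congrArg
    (fun x => (P.isoLeftDerivedObj ((linearYoneda R C).obj Y).rightOp n).inv.unop ≫ x) h₂) ?_)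
  · refine Eq.trans (Category.assoc _ _ _).symm ?_
    refine Eq.trans ?_ (Category.assoc _ _ _)
    exact congrArg (fun x => x ≫ _) h
  · exact (Category.assoc _ _ _).symm

/-- The cocycles of `Hom(P, Y)`. -/
def cocycles (R : Type t) [Ring R] [Linear R C] {X : C} (P : ProjectiveResolution X) (n : ℕ)
    (Y : C) : Submodule R (P.complex.X n ⟶ Y) :=
  LinearMap.ker (Linear.leftComp R Y (P.complex.d (n + 1) n))

/-- The map from the concrete cocycles of `Hom(P, Y)` to the cycles object. -/
noncomputable def cocyclesLift {X : C} (P : ProjectiveResolution X) (n : ℕ) (Y : C) :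
    P.cocycles R n Y →ₗ[R] (P.complex.linearYonedaObj R Y).cycles n :=
  ((P.complex.linearYonedaObj R Y).liftCycles (k := ModuleCat.ofHom (P.cocycles R n Y).subtype)
    (n + 1) (by simp) (by ext x; exact x.2)).hom

/-- The cohomology class of a cocycle of `Hom(P, Y)`. -/
noncomputable def cocyclesToHomology {X : C} (P : ProjectiveResolution X) (n : ℕ) (Y : C) :
    P.cocycles R n Y →ₗ[R] (P.complex.linearYonedaObj R Y).homology n :=
  ((P.complex.linearYonedaObj R Y).homologyπ n).hom ∘ₗ P.cocyclesLift n Y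

lemma iCycles_liftCycles {X : C} (P : ProjectiveResolution X) (n : ℕ) (Y : C)
    (x : P.cocycles R n Y) :
    ((P.complex.linearYonedaObj R Y).iCycles n).hom (P.cocyclesLift n Y x) = x.1 := by
  have := (P.complex.linearYonedaObj R Y).liftCycles_i
    (k := ModuleCat.ofHom (P.cocycles R n Y).subtype) (i := n) (n + 1) (by simp)
    (by ext x; exact x.2)
  exact congrArg (fun f => f.hom x) this

lemma cocyclesToHomology_naturality {X X' : C} {P : ProjectiveResolution X}
    {P' : ProjectiveResolution X'} {f : X' ⟶ X} (φ : Hom P' P f) (Y : C) (n : ℕ)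
    (x : P.cocycles R n Y) (x' : P'.cocycles R n Y) (h : x'.1 = φ.hom.f n ≫ x.1) :
    (HomologicalComplex.homologyMap (linearYonedaMap R φ Y) n).hom
      (P.cocyclesToHomology n Y x) = P'.cocyclesToHomology n Y x' := by
  have h₁ := congrArg (fun f => f.hom (P.cocyclesLift n Y x))
    (HomologicalComplex.homologyπ_naturality (linearYonedaMap R φ Y) n)
  refine h₁.trans ?_
  refine congrArg (((P'.complex.linearYonedaObj R Y).homologyπ n).hom) ?_
  apply (ModuleCat.mono_iff_injective ((P'.complex.linearYonedaObj R Y).iCycles n)).1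
    inferInstance
  rw [P'.iCycles_liftCycles, h]
  refine (congrArg (fun f => f.hom (P.cocyclesLift n Y x))
    (HomologicalComplex.cyclesMap_i (linearYonedaMap R φ Y) n)).trans ?_
  refine (congrArg ((linearYonedaMap R φ Y).f n).hom (P.iCycles_liftCycles n Y x)).trans ?_
  rfl

lemma cocyclesLift_surjective {X : C} (P : ProjectiveResolution X) (n : ℕ) (Y : C) :
    Function.Surjective (P.cocyclesLift (R := R) n Y) := by
  intro z
  refine ⟨⟨((P.complex.linearYonedaObj R Y).iCycles n).hom z, ?_⟩, ?_⟩
  · exact congrArg (fun f => f.hom z) ((P.complex.linearYonedaObj R Y).iCycles_d n (n + 1))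
  · apply (ModuleCat.mono_iff_injective ((P.complex.linearYonedaObj R Y).iCycles n)).1
      inferInstance
    rw [iCycles_liftCycles]

lemma cocyclesToHomology_surjective {X : C} (P : ProjectiveResolution X) (n : ℕ) (Y : C) :
    Function.Surjective (P.cocyclesToHomology (R := R) n Y) := by
  refine Function.Surjective.comp (g := ((P.complex.linearYonedaObj R Y).homologyπ n).hom)
    ((ModuleCat.epi_iff_surjective _).1 inferInstance) (P.cocyclesLift_surjective n Y)

open Abelian

variable [HasExt.{w} C]

lemma smul_extMk {X Y : C} (P : ProjectiveResolution X) {n : ℕ} (r : R) (f : P.complex.X n ⟶ Y)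
    (m : ℕ) (hm : n + 1 = m) (hf : P.complex.d m n ≫ f = 0) :
    r • P.extMk f m hm hf = P.extMk (r • f) m hm (by simp [hf]) := by
  rw [Ext.smul_eq_comp_mk₀, extMk_comp_mk₀]
  simp

lemma extMk_zero_eq_zero_iff {X Y : C} (P : ProjectiveResolution X) (f : P.complex.X 0 ⟶ Y)
    (hf : P.complex.d 1 0 ≫ f = 0) :
    P.extMk f 1 rfl hf = 0 ↔ f = 0 := by
  refine ⟨fun h => ?_, by rintro rfl; simp⟩
  have h := congrArg P.extEquivCohomologyClass h
  rw [extEquivCohomologyClass_extMk, extEquivCohomologyClass_zero,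
    CochainComplex.HomComplex.CohomologyClass.mk_eq_zero_iff,
    CochainComplex.HomComplex.Cocycle.toSingleMk_mem_coboundaries_iff _ _ _ _ _ 1 (by simp)] at h
  obtain ⟨g, hg⟩ := h
  have : g = 0 := (P.cochainComplex.isZero_of_isStrictlyLE 0 1).eq_of_src _ _
  rw [this, Limits.comp_zero] at hg
  rw [← cancel_epi (P.cochainComplexXIso (-(0 : ℕ)) 0 rfl).hom, ← hg, Limits.comp_zero]

/-- The `Ext` class of a cocycle of `Hom(P, Y)`. -/
noncomputable def cocyclesToExt {X : C} (P : ProjectiveResolution X) (n : ℕ) (Y : C) :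
    P.cocycles R n Y →ₗ[R] Ext X Y n where
  toFun f := P.extMk f.1 (n + 1) rfl f.2
  map_add' _ _ := (P.add_extMk _ _ _ _ _ _).symm
  map_smul' _ _ := (P.smul_extMk _ _ _ _ _).symm

lemma ker_cocyclesToHomology {X : C} (P : ProjectiveResolution X) (n : ℕ) (Y : C) :
    LinearMap.ker (P.cocyclesToHomology (R := R) n Y) =
      LinearMap.ker (P.cocyclesToExt (R := R) n Y) := by
  ext x
  have hx : x ∈ LinearMap.ker (P.cocyclesToHomology (R := R) n Y) ↔
      ∃ y, ((P.complex.linearYonedaObj R Y).d ((ComplexShape.up ℕ).prev n) n).hom y = x.1 := by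
    have hex := ShortComplex.exact_of_g_is_cokernel (ShortComplex.mk _ _
      ((P.complex.linearYonedaObj R Y).toCycles_comp_homologyπ _ n))
      ((P.complex.linearYonedaObj R Y).homologyIsCokernel ((ComplexShape.up ℕ).prev n) n rfl)
    rw [ShortComplex.moduleCat_exact_iff] at hex
    constructor
    · intro h
      obtain ⟨y, hy⟩ := hex (P.cocyclesLift n Y x) h
      refine ⟨y, ?_⟩
      rw [← P.iCycles_liftCycles n Y x, ← hy]
      exact (congrArg (fun f => f.hom y) ((P.complex.linearYonedaObj R Y).toCycles_i _ n)).symm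
    · rintro ⟨y, hy⟩
      have : P.cocyclesLift n Y x = ((P.complex.linearYonedaObj R Y).toCycles _ n).hom y := by
        apply (ModuleCat.mono_iff_injective ((P.complex.linearYonedaObj R Y).iCycles n)).1
          inferInstance
        rw [iCycles_liftCycles, ← hy]
        exact (congrArg (fun f => f.hom y) ((P.complex.linearYonedaObj R Y).toCycles_i _ n)).symm
      change ((P.complex.linearYonedaObj R Y).homologyπ n).hom (P.cocyclesLift n Y x) = 0
      rw [this]
      exact (congrArg (fun f => f.hom y)
        ((P.complex.linearYonedaObj R Y).toCycles_comp_homologyπ _ n))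
  rw [hx, LinearMap.mem_ker]
  change _ ↔ P.extMk x.1 (n + 1) rfl x.2 = 0
  cases n with
  | zero =>
    refine Iff.trans ?_ (P.extMk_zero_eq_zero_iff x.1 x.2).symm
    have : (P.complex.linearYonedaObj R Y).d ((ComplexShape.up ℕ).prev 0) 0 = 0 :=
      (P.complex.linearYonedaObj R Y).shape _ _ (by simp)
    rw [this]
    constructor
    · rintro ⟨y, hy⟩
      exact hy.symm
    · intro h
      exact ⟨0, h.symm⟩
  | succ k =>
    refine Iff.trans ?_ (P.extMk_eq_zero_iff x.1 _ rfl x.2 k rfl).symm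
    have : (ComplexShape.up ℕ).prev (k + 1) = k := by simp
    rw [this]
    rfl

/-- The cohomology of `Hom(P, Y)`, for `P` a projective resolution of `X`, is `Ext X Y`. -/
noncomputable def homologyEquivExt {X : C} (P : ProjectiveResolution X) (n : ℕ) (Y : C) :
    (P.complex.linearYonedaObj R Y).homology n ≃ₗ[R] Ext X Y n :=
  ((P.cocyclesToHomology n Y).quotKerEquivOfSurjective
    (P.cocyclesToHomology_surjective n Y)).symm ≪≫ₗ
  Submodule.quotEquivOfEq _ _ (P.ker_cocyclesToHomology n Y) ≪≫ₗ
  (P.cocyclesToExt n Y).quotKerEquivOfSurjective (fun x => by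
    obtain ⟨f, hf, rfl⟩ := P.extMk_surjective x (n + 1) rfl
    exact ⟨⟨f, hf⟩, rfl⟩)

lemma homologyEquivExt_apply {X : C} (P : ProjectiveResolution X) (n : ℕ) (Y : C)
    (x : P.cocycles R n Y) :
    P.homologyEquivExt n Y (P.cocyclesToHomology n Y x) = P.cocyclesToExt n Y x := by
  have : ((P.cocyclesToHomology n Y).quotKerEquivOfSurjective
    (P.cocyclesToHomology_surjective n Y)).symm (P.cocyclesToHomology n Y x) =
      Submodule.Quotient.mk x := by
    rw [LinearEquiv.symm_apply_eq]
    rfl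
  simp only [homologyEquivExt, LinearEquiv.trans_apply, this]
  rfl

lemma homologyEquivExt_naturality {X X' : C} {P : ProjectiveResolution X}
    {P' : ProjectiveResolution X'} {f : X' ⟶ X} (φ : Hom P' P f) (Y : C) (n : ℕ)
    (x : (P.complex.linearYonedaObj R Y).homology n) :
    P'.homologyEquivExt n Y ((HomologicalComplex.homologyMap (linearYonedaMap R φ Y) n).hom x) =
      (Ext.mk₀ f).comp (P.homologyEquivExt n Y x) (zero_add n) := by
  obtain ⟨x, rfl⟩ := P.cocyclesToHomology_surjective n Y x
  have hx : P'.complex.d (n + 1) n ≫ φ.hom.f n ≫ x.1 = 0 := by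
    have : P.complex.d (n + 1) n ≫ x.1 = 0 := x.2
    rw [← HomologicalComplex.Hom.comm_assoc, this, Limits.comp_zero]
  let x' : P'.cocycles R n Y := ⟨φ.hom.f n ≫ x.1, hx⟩
  refine (congrArg (P'.homologyEquivExt n Y)
    (cocyclesToHomology_naturality φ Y n x x' rfl)).trans ?_
  refine (P'.homologyEquivExt_apply n Y x').trans ?_
  refine Eq.trans ?_ (congrArg (fun z => (Ext.mk₀ f).comp z (zero_add n))
    (P.homologyEquivExt_apply n Y x)).symm
  exact (mk₀_comp_extMk x.1 (n + 1) rfl x.2 φ).symm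

end
end CategoryTheory.ProjectiveResolution

namespace CategoryTheory.ProjectiveResolution

/-- A lift of a morphism between two projective resolutions. -/
noncomputable def homLift {C : Type u} [Category.{v} C] [Abelian C] {X X' : C}
    (P' : ProjectiveResolution X') (P : ProjectiveResolution X) (f : X' ⟶ X) : Hom P' P f where
  hom := lift f P' P
  hom_f_zero_comp_π_f_zero := by
    have := lift_commutes_zero f P' P
    simpa using this

end CategoryTheory.ProjectiveResolution

namespace CategoryTheory.Abelian

section
open ProjectiveResolution
variable {R : Type t} [Ring R] {C : Type u} [Category.{v} C] [Abelian C] [Linear R C]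
  [EnoughProjectives C] [HasExt.{w} C]

/-- The `Ext` defined as a derived functor agrees with the one defined as a group of morphisms in
the derived category. -/
noncomputable def derivedExtEquiv (R : Type t) [Ring R] [Linear R C] (X Y : C) (n : ℕ) :
    ((_root_.Ext R C n).obj (Opposite.op X)).obj Y ≃ₗ[R] Ext X Y n :=
  ((projectiveResolution X).isoExt n Y).toLinearEquiv ≪≫ₗ
    (projectiveResolution X).homologyEquivExt n Y

lemma derivedExtEquiv_naturality {X X' : C} (f : X' ⟶ X) (Y : C) (n : ℕ)
    (x : ((_root_.Ext R C n).obj (Opposite.op X)).obj Y) :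
    derivedExtEquiv R X' Y n ((((_root_.Ext R C n).map f.op).app Y).hom x) =
      (Ext.mk₀ f).comp (derivedExtEquiv R X Y n x) (zero_add n) := by
  have h := isoExt_hom_naturality (R := R)
    (homLift (projectiveResolution X') (projectiveResolution X) f) Y n
  have h' := congrArg (fun g => g.hom x) h
  refine (congrArg ((projectiveResolution X').homologyEquivExt n Y) h').trans ?_
  exact homologyEquivExt_naturality _ Y n _

end
end CategoryTheory.Abelian

namespace LocalCohomologyAux

variable {A : Type u} [CommRing A]

/-- The projection `A ⧸ J ^ n ⟶ A ⧸ J ^ m` for `m ≤ n`. -/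
noncomputable def powQuotMap (J : Ideal A) {m n : ℕ} (h : m ≤ n) :
    ModuleCat.of A (A ⧸ J ^ n) ⟶ ModuleCat.of A (A ⧸ J ^ m) :=
  ModuleCat.ofHom (Submodule.mapQ _ _ LinearMap.id (Ideal.pow_le_pow_right h))

/-- The transition maps of the directed system `Ext (A ⧸ J ^ n) M i`. -/
noncomputable def extSystem (J : Ideal A) (i : ℕ) (M : ModuleCat.{u} A) (m n : ℕ) (h : m ≤ n) :
    Abelian.Ext (ModuleCat.of A (A ⧸ J ^ m)) M i →ₗ[A]
      Abelian.Ext (ModuleCat.of A (A ⧸ J ^ n)) M i :=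
  (Abelian.Ext.mk₀ (powQuotMap J h)).precompOfLinear A M (zero_add i)

lemma extSystem_apply (J : Ideal A) (i : ℕ) (M : ModuleCat.{u} A) {m n : ℕ} (h : m ≤ n)
    (x : Abelian.Ext (ModuleCat.of A (A ⧸ J ^ m)) M i) :
    extSystem J i M m n h x = (Abelian.Ext.mk₀ (powQuotMap J h)).comp x (zero_add i) := rfl

lemma powQuotMap_comp (J : Ideal A) {a b c : ℕ} (h : a ≤ b) (h' : b ≤ c) :
    powQuotMap J h' ≫ powQuotMap J h = powQuotMap J (h.trans h') := by
  refine ModuleCat.hom_ext (LinearMap.ext fun x => ?_)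
  obtain ⟨x, rfl⟩ := Submodule.Quotient.mk_surjective _ x
  rfl

lemma powQuotMap_refl (J : Ideal A) (a : ℕ) :
    powQuotMap J (le_refl a) = 𝟙 _ := by
  refine ModuleCat.hom_ext (LinearMap.ext fun x => ?_)
  obtain ⟨x, rfl⟩ := Submodule.Quotient.mk_surjective _ x
  rfl

instance (J : Ideal A) (i : ℕ) (M : ModuleCat.{u} A) :
    DirectedSystem (fun n => Abelian.Ext (ModuleCat.of A (A ⧸ J ^ n)) M i)
      (fun _ _ h => extSystem J i M _ _ h) where
  map_self := by
    intro n x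
    rw [extSystem_apply, powQuotMap_refl]
    simp
  map_map := by
    intro a b c h h' x
    rw [extSystem_apply, extSystem_apply, extSystem_apply, ← powQuotMap_comp J h h',
      ← Abelian.Ext.mk₀_comp_mk₀_assoc]

/-- Local cohomology, as the direct limit of the modules `Ext (A ⧸ J ^ n) M i`. -/
abbrev H (J : Ideal A) (i : ℕ) (M : ModuleCat.{u} A) : Type u :=
  Module.DirectLimit (fun n => Abelian.Ext (ModuleCat.of A (A ⧸ J ^ n)) M i)
    (extSystem J i M)

section Comparison

open Opposite Limits localCohomology

variable (J : Ideal A) (i : ℕ) (M : ModuleCat.{u} A)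

/-- The structure maps of `localCohomology` as a colimit of derived functors. -/
noncomputable def derivedι (n : ℕ) :
    ((_root_.Ext A (ModuleCat.{u} A) i).obj (op (ModuleCat.of A (A ⧸ J ^ n)))).obj M →ₗ[A]
      (localCohomology J i).obj M :=
  ((colimit.ι (diagram (idealPowersDiagram J) i) (op (op n))).app M).hom

lemma derivedι_map {m n : ℕ} (h : m ≤ n)
    (x : ((_root_.Ext A (ModuleCat.{u} A) i).obj (op (ModuleCat.of A (A ⧸ J ^ m)))).obj M) :
    derivedι J i M n
      ((((_root_.Ext A (ModuleCat.{u} A) i).map (powQuotMap J h).op).app M).hom x) =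
      derivedι J i M m x := by
  have := colimit.w (diagram (idealPowersDiagram J) i) (homOfLE h).op.op
  exact congrArg (fun f => (f.app M).hom x) this

instance preservesFilteredColimits_forget :
    PreservesFilteredColimitsOfSize.{0, 0} (forget (ModuleCat.{u} A)) :=
  preservesFilteredColimitsOfSize_shrink.{0, u, 0, u} _

lemma exists_derivedι (x : (localCohomology J i).obj M) :
    ∃ n y, derivedι J i M n y = x := by
  obtain ⟨n, y, h⟩ := Concrete.isColimit_exists_rep _
    (isColimitOfPreserves ((evaluation _ _).obj M)
      (colimit.isColimit (diagram (idealPowersDiagram J) i))) x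
  exact ⟨n.unop.unop, y, h⟩

lemma exists_map_eq_zero_of_derivedι_eq_zero {n : ℕ}
    (x : ((_root_.Ext A (ModuleCat.{u} A) i).obj (op (ModuleCat.of A (A ⧸ J ^ n)))).obj M)
    (hx : derivedι J i M n x = 0) :
    ∃ (m : ℕ) (h : n ≤ m),
      (((_root_.Ext A (ModuleCat.{u} A) i).map (powQuotMap J h).op).app M).hom x = 0 := by
  obtain ⟨k, f, g, h⟩ := Concrete.isColimit_exists_of_rep_eq _
    (isColimitOfPreserves ((evaluation _ _).obj M)
      (colimit.isColimit (diagram (idealPowersDiagram J) i)))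
      (i := op (op n)) (j := op (op n)) x 0 (hx.trans (map_zero (derivedι J i M n)).symm)
  refine ⟨k.unop.unop, leOfHom f.unop.unop, Eq.trans h ?_⟩
  exact map_zero ((diagram (idealPowersDiagram J) i).map g |>.app M).hom

/-- The comparison map from the direct limit `H J i M` to `localCohomology`. -/
noncomputable def toLocalCohomology : H J i M →ₗ[A] (localCohomology J i).obj M :=
  Module.DirectLimit.lift A ℕ _ _
    (fun n => derivedι J i M n ∘ₗ (Abelian.derivedExtEquiv A _ M i).symm.toLinearMap) (by
      intro m n h x
      obtain ⟨x, rfl⟩ := (Abelian.derivedExtEquiv A _ M i).surjective x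
      rw [extSystem_apply, ← Abelian.derivedExtEquiv_naturality]
      simp only [LinearMap.comp_apply, LinearEquiv.coe_coe, LinearEquiv.symm_apply_apply]
      exact derivedι_map J i M h x)

lemma toLocalCohomology_of (n : ℕ)
    (x : ((_root_.Ext A (ModuleCat.{u} A) i).obj (op (ModuleCat.of A (A ⧸ J ^ n)))).obj M) :
    toLocalCohomology J i M (Module.DirectLimit.of A ℕ _ _ n (Abelian.derivedExtEquiv A _ M i x)) =
      derivedι J i M n x := by
  simp [toLocalCohomology]

/-- The direct limit `H J i M` computes `localCohomology`. -/
noncomputable def equivLocalCohomology : H J i M ≃ₗ[A] (localCohomology J i).obj M :=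
  LinearEquiv.ofBijective (toLocalCohomology J i M) (by
    constructor
    · rw [injective_iff_map_eq_zero]
      intro x hx
      obtain ⟨n, x, rfl⟩ := Module.DirectLimit.exists_of x
      obtain ⟨x, rfl⟩ := (Abelian.derivedExtEquiv A _ M i).surjective x
      rw [toLocalCohomology_of] at hx
      obtain ⟨m, h, hm⟩ := exists_map_eq_zero_of_derivedι_eq_zero J i M x hx
      rw [← Module.DirectLimit.of_f (hij := h), extSystem_apply,
        ← Abelian.derivedExtEquiv_naturality]
      refine (congrArg _ (congrArg _ hm)).trans ?_
      rw [map_zero, map_zero]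
    · intro y
      obtain ⟨n, y, rfl⟩ := exists_derivedι J i M y
      exact ⟨_, toLocalCohomology_of J i M n y⟩)

end Comparison

section LongExactSequence

open Abelian

variable {A : Type u} [CommRing A] (J : Ideal A)

/-- The canonical map from `Ext (A ⧸ J ^ n) M i` to local cohomology. -/
noncomputable def ofExt (i : ℕ) (M : ModuleCat.{u} A) (n : ℕ) :
    Ext (ModuleCat.of A (A ⧸ J ^ n)) M i →ₗ[A] H J i M :=
  Module.DirectLimit.of A ℕ (fun n => Ext (ModuleCat.of A (A ⧸ J ^ n)) M i) (extSystem J i M) n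

variable {J} in
lemma exists_ofExt {i : ℕ} {M : ModuleCat.{u} A} (x : H J i M) : ∃ n y, ofExt J i M n y = x :=
  Module.DirectLimit.exists_of x

lemma ofExt_extSystem {i : ℕ} {M : ModuleCat.{u} A} {m n : ℕ} (h : m ≤ n)
    (x : Ext (ModuleCat.of A (A ⧸ J ^ m)) M i) :
    ofExt J i M n ((Ext.mk₀ (powQuotMap J h)).comp x (zero_add i)) = ofExt J i M m x :=
  Module.DirectLimit.of_f (f := extSystem J i M) (hij := h)

variable {J} in
lemma exists_of_ofExt_eq_zero {i : ℕ} {M : ModuleCat.{u} A} {n : ℕ}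
    {x : Ext (ModuleCat.of A (A ⧸ J ^ n)) M i} (hx : ofExt J i M n x = 0) :
    ∃ (m : ℕ) (h : n ≤ m), (Ext.mk₀ (powQuotMap J h)).comp x (zero_add i) = 0 :=
  Module.DirectLimit.of.zero_exact (f := extSystem J i M) hx

/-- Postcomposition with an `Ext` class, as a map on local cohomology. -/
noncomputable def postcomp {M N : ModuleCat.{u} A} {j : ℕ} (β : Ext M N j) {a b : ℕ}
    (h : a + j = b) : H J a M →ₗ[A] H J b N :=
  Module.DirectLimit.map (f := extSystem J a M) (f' := extSystem J b N)
    (fun _ => β.postcompOfLinear A _ h) (by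
    intro m n hmn
    refine LinearMap.ext fun x => ?_
    exact (Ext.comp_assoc (Ext.mk₀ (powQuotMap J hmn)) x β (zero_add a) h (by omega)))

lemma postcomp_ofExt {M N : ModuleCat.{u} A} {j : ℕ} (β : Ext M N j) {a b : ℕ}
    (h : a + j = b) (n : ℕ) (x : Ext (ModuleCat.of A (A ⧸ J ^ n)) M a) :
    postcomp J β h (ofExt J a M n x) = ofExt J b N n (x.comp β h) :=
  Module.DirectLimit.map_apply_of (f := extSystem J a M) (f' := extSystem J b N) _ _ _

lemma postcomp_exact {M N P : ModuleCat.{u} A} {j k : ℕ} (β : Ext M N j) (γ : Ext N P k)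
    {a b c d : ℕ} (h : a + j = b) (h' : b + k = c) (hd : j + k = d) (h₀ : β.comp γ hd = 0)
    (hex : ∀ (n : ℕ) (x : Ext (ModuleCat.of A (A ⧸ J ^ n)) N b), x.comp γ h' = 0 →
      ∃ y : Ext (ModuleCat.of A (A ⧸ J ^ n)) M a, y.comp β h = x) :
    Function.Exact (postcomp J β h) (postcomp J γ h') := by
  intro x
  constructor
  · intro hx
    obtain ⟨n, x, rfl⟩ := exists_ofExt x
    rw [postcomp_ofExt] at hx
    obtain ⟨m, hm, h₁⟩ := exists_of_ofExt_eq_zero hx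
    rw [← Ext.comp_assoc _ _ _ (zero_add b) h' (by omega)] at h₁
    obtain ⟨y, hy⟩ := hex m _ h₁
    refine ⟨ofExt J a M m y, ?_⟩
    rw [postcomp_ofExt, hy, ofExt_extSystem]
  · rintro ⟨y, rfl⟩
    obtain ⟨n, y, rfl⟩ := exists_ofExt y
    rw [postcomp_ofExt, postcomp_ofExt, Ext.comp_assoc _ _ _ h hd (by omega), h₀,
      Ext.comp_zero, map_zero]

section Modules

variable (i : ℕ) {L M N : Type u} [AddCommGroup L] [Module A L] [AddCommGroup M] [Module A M]
  [AddCommGroup N] [Module A N]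

/-- Local cohomology of an unbundled module. -/
abbrev LC (M : Type u) [AddCommGroup M] [Module A M] : Type u := H J i (ModuleCat.of A M)

/-- Functoriality of local cohomology. -/
noncomputable def LCmap (f : M →ₗ[A] N) : LC J i M →ₗ[A] LC J i N :=
  postcomp J (Ext.mk₀ (ModuleCat.ofHom f)) (add_zero i)

lemma LCmap_ofExt (f : M →ₗ[A] N) (n : ℕ) (x) :
    LCmap J i f (ofExt J i _ n x) =
      ofExt J i _ n (x.comp (Ext.mk₀ (ModuleCat.ofHom f)) (add_zero i)) :=
  postcomp_ofExt _ _ _ _ _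

lemma LCmap_smul_id (r : A) (x : LC J i M) :
    LCmap J i (r • (LinearMap.id : M →ₗ[A] M)) x = r • x := by
  obtain ⟨n, x, rfl⟩ := exists_ofExt x
  rw [LCmap_ofExt, ← map_smul, Ext.smul_eq_comp_mk₀]
  rfl

lemma exists_pow_smul_eq_zero (x : LC J i M) : ∃ n, ∀ r ∈ J ^ n, r • x = 0 := by
  obtain ⟨n, x, rfl⟩ := exists_ofExt x
  refine ⟨n, fun r hr => ?_⟩
  have hz : r • 𝟙 (ModuleCat.of A (A ⧸ J ^ n)) = 0 := by
    refine ModuleCat.hom_ext (LinearMap.ext fun y => ?_)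
    obtain ⟨y, rfl⟩ := Submodule.Quotient.mk_surjective _ y
    change r • (Submodule.Quotient.mk y : A ⧸ J ^ n) = 0
    rw [← Submodule.Quotient.mk_smul, Submodule.Quotient.mk_eq_zero]
    exact Ideal.mul_mem_right _ _ hr
  have : r • x = 0 := by
    rw [← Ext.mk₀_id_comp x, ← Ext.smul_comp, ← Ext.mk₀_smul, hz]
    simp
  rw [← map_smul, this, map_zero]

section Exact

variable {f : L →ₗ[A] M} {g : M →ₗ[A] N}

lemma ofHom_comp_ofHom_eq_zero (hfg : Function.Exact f g) :
    ModuleCat.ofHom f ≫ ModuleCat.ofHom g = 0 := by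
  ext x; exact hfg.apply_apply_eq_zero x

lemma shortExact (hf : Function.Injective f) (hfg : Function.Exact f g)
    (hg : Function.Surjective g) :
    (ShortComplex.mk (ModuleCat.ofHom f) (ModuleCat.ofHom g)
      (ofHom_comp_ofHom_eq_zero hfg)).ShortExact where
  exact := (ShortComplex.moduleCat_exact_iff _).2 fun x hx => (hfg x).1 hx
  mono_f := (ModuleCat.mono_iff_injective _).2 hf
  epi_g := (ModuleCat.epi_iff_surjective _).2 hg

lemma LCmap_exact (hf : Function.Injective f) (hfg : Function.Exact f g)
    (hg : Function.Surjective g) :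
    Function.Exact (LCmap J i f) (LCmap J i g) := by
  refine postcomp_exact J _ _ _ _ (add_zero 0) ?_ ?_
  · rw [Ext.mk₀_comp_mk₀, ofHom_comp_ofHom_eq_zero hfg, Ext.mk₀_zero]
  · intro n x hx
    exact Ext.covariant_sequence_exact₂ _ (shortExact hf hfg hg) x hx

lemma exists_connecting (hf : Function.Injective f) (hfg : Function.Exact f g)
    (hg : Function.Surjective g) :
    ∃ δ : LC J i N →ₗ[A] LC J (i + 1) L,
    Function.Exact (LCmap J i g) δ ∧ Function.Exact δ (LCmap J (i + 1) f) := by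
  refine ⟨postcomp J (shortExact hf hfg hg).extClass rfl, ?_, ?_⟩
  · refine postcomp_exact J _ _ _ _ (zero_add 1) (shortExact hf hfg hg).comp_extClass ?_
    intro n x hx
    exact Ext.covariant_sequence_exact₃ _ (shortExact hf hfg hg) x rfl hx
  · refine postcomp_exact J _ _ _ _ (add_zero 1) (shortExact hf hfg hg).extClass_comp ?_
    intro n x hx
    exact Ext.covariant_sequence_exact₁ _ (shortExact hf hfg hg) x hx rfl

end Exact

lemma LC_succ_eq_zero_of_injective [Module.Injective A M] (x : LC J (i + 1) M) : x = 0 := by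
  have := Module.injective_object_of_injective_module A M
  obtain ⟨n, x, rfl⟩ := exists_ofExt x
  rw [Ext.eq_zero_of_injective x, map_zero]

/-- The `J`-power torsion submodule `Γ_J(M)`. -/
def torsionPart (M : Type u) [AddCommGroup M] [Module A M] : Submodule A M where
  carrier := {x | ∃ n, ∀ r ∈ J ^ n, r • x = 0}
  zero_mem' := ⟨0, by simp⟩
  add_mem' := by
    rintro x y ⟨m, hm⟩ ⟨n, hn⟩
    refine ⟨m + n, fun r hr => ?_⟩
    rw [smul_add, hm r (Ideal.pow_le_pow_right (by omega) hr),
      hn r (Ideal.pow_le_pow_right (by omega) hr), add_zero]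
  smul_mem' := by
    rintro a x ⟨m, hm⟩
    exact ⟨m, fun r hr => by rw [smul_comm, hm r hr, smul_zero]⟩

/-- Evaluation at the class of `1`. -/
noncomputable def evalOneHom (n : ℕ) : (ModuleCat.of A (A ⧸ J ^ n) ⟶ ModuleCat.of A M) →ₗ[A] M :=
  LinearMap.applyₗ (Submodule.Quotient.mk 1 : A ⧸ J ^ n) ∘ₗ
    (ModuleCat.homLinearEquiv (S := A)).toLinearMap

lemma evalOneHom_powQuotMap {m n : ℕ} (h : m ≤ n)
    (φ : ModuleCat.of A (A ⧸ J ^ m) ⟶ ModuleCat.of A M) :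
    evalOneHom J n (powQuotMap J h ≫ φ) = evalOneHom J m φ := rfl

/-- The embedding of `H⁰` into `M` induced by evaluation at the class of `1`. -/
noncomputable def evalOne : LC J 0 M →ₗ[A] M :=
  Module.DirectLimit.lift A ℕ (fun n => Ext (ModuleCat.of A (A ⧸ J ^ n)) (ModuleCat.of A M) 0)
    (extSystem J 0 (ModuleCat.of A M))
    (fun n => evalOneHom J n ∘ₗ (Ext.linearEquiv₀ (R := A)).toLinearMap) (by
    intro m n h x
    obtain ⟨φ, rfl⟩ := (Ext.linearEquiv₀ (R := A)).symm.surjective x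
    rw [extSystem_apply, LinearMap.comp_apply, LinearMap.comp_apply, LinearEquiv.coe_coe,
      LinearEquiv.coe_coe, LinearEquiv.apply_symm_apply, ← evalOneHom_powQuotMap J h]
    congr 1
    rw [← LinearEquiv.eq_symm_apply]
    exact Ext.mk₀_comp_mk₀ _ _)

lemma exists_ofExt_mk₀ (x : LC J 0 M) :
    ∃ (n : ℕ) (φ : ModuleCat.of A (A ⧸ J ^ n) ⟶ ModuleCat.of A M),
      ofExt J 0 _ n (Ext.mk₀ φ) = x := by
  obtain ⟨n, x, rfl⟩ := exists_ofExt x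
  exact ⟨n, Ext.linearEquiv₀ (R := A) x, by rw [Ext.mk₀_linearEquiv₀_apply]⟩

lemma evalOne_ofExt_mk₀ (n : ℕ) (φ : ModuleCat.of A (A ⧸ J ^ n) ⟶ ModuleCat.of A M) :
    evalOne J (ofExt J 0 _ n (Ext.mk₀ φ)) = φ.hom (Submodule.Quotient.mk 1 : A ⧸ J ^ n) := by
  refine (Module.DirectLimit.lift_of (f := extSystem J 0 (ModuleCat.of A M)) _ _ _).trans ?_
  refine congrArg (evalOneHom J n) ?_
  exact (Ext.linearEquiv₀ (R := A)).apply_symm_apply φ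

lemma evalOne_LCmap (f : M →ₗ[A] N) (x : LC J 0 M) :
    evalOne J (LCmap J 0 f x) = f (evalOne J x) := by
  obtain ⟨n, φ, rfl⟩ := exists_ofExt_mk₀ J x
  rw [LCmap_ofExt, evalOne_ofExt_mk₀, Ext.mk₀_comp_mk₀, evalOne_ofExt_mk₀]
  rfl

lemma evalOne_injective : Function.Injective (evalOne J (M := M)) := by
  rw [injective_iff_map_eq_zero]
  intro x hx
  obtain ⟨n, φ, rfl⟩ := exists_ofExt_mk₀ J x
  rw [evalOne_ofExt_mk₀] at hx
  have : φ = 0 := by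
    refine ModuleCat.hom_ext (LinearMap.ext fun y => ?_)
    obtain ⟨y, rfl⟩ := Submodule.Quotient.mk_surjective _ y
    have : (Submodule.Quotient.mk y : A ⧸ J ^ n) = y • Submodule.Quotient.mk 1 := by
      rw [← Submodule.Quotient.mk_smul, smul_eq_mul, mul_one]
    rw [this, map_smul, hx]
    simp
  rw [this, Ext.mk₀_zero, map_zero]

lemma range_evalOne : LinearMap.range (evalOne J (M := M)) = torsionPart J M := by
  ext y
  constructor
  · rintro ⟨x, rfl⟩
    obtain ⟨n, hn⟩ := exists_pow_smul_eq_zero J 0 x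
    exact ⟨n, fun r hr => by rw [← map_smul, hn r hr, map_zero]⟩
  · rintro ⟨n, hn⟩
    refine ⟨ofExt J 0 _ n (Ext.mk₀ (ModuleCat.ofHom
      (Submodule.liftQ (J ^ n) (LinearMap.toSpanSingleton A M y) fun r hr => hn r hr))), ?_⟩
    rw [evalOne_ofExt_mk₀]
    exact one_smul A y

/-- `H⁰` is the torsion part. -/
noncomputable def LCZeroEquiv : LC J 0 M ≃ₗ[A] torsionPart J M :=
  LinearEquiv.ofInjective (evalOne J) (evalOne_injective J) ≪≫ₗ
    LinearEquiv.ofEq _ _ (range_evalOne J)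

lemma LCmap_zero_surjective (hM : torsionPart J M = ⊤)
    (f : M →ₗ[A] N) (hf : Function.Surjective f) : Function.Surjective (LCmap J 0 f) := by
  intro y
  obtain ⟨x, hx⟩ := hf (evalOne J y)
  have : x ∈ LinearMap.range (evalOne J (M := M)) := by rw [range_evalOne, hM]; trivial
  obtain ⟨x, rfl⟩ := this
  exact ⟨x, evalOne_injective J (by rw [evalOne_LCmap, hx])⟩

end Modules

end LongExactSequence

section Torsion

variable {A : Type u} [CommRing A] (J : Ideal A)

section Modules

variable {L M N : Type u} [AddCommGroup L] [Module A L] [AddCommGroup M] [Module A M]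
  [AddCommGroup N] [Module A N]

lemma mem_torsionPart {x : M} : x ∈ torsionPart J M ↔ ∃ n, ∀ r ∈ J ^ n, r • x = 0 := Iff.rfl

lemma map_mem_torsionPart (f : M →ₗ[A] N) {x : M} (hx : x ∈ torsionPart J M) :
    f x ∈ torsionPart J N := by
  obtain ⟨n, hn⟩ := hx
  exact ⟨n, fun r hr => by rw [← map_smul, hn r hr, map_zero]⟩

lemma mem_torsionPart_of_map_mem {f : M →ₗ[A] N} (hf : Function.Injective f) {x : M}
    (hx : f x ∈ torsionPart J N) : x ∈ torsionPart J M := by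
  obtain ⟨n, hn⟩ := hx
  exact ⟨n, fun r hr => hf (by rw [map_smul, hn r hr, map_zero])⟩

lemma torsionPart_torsionPart : torsionPart J (torsionPart J M) = ⊤ :=
  eq_top_iff.2 fun x _ =>
    mem_torsionPart_of_map_mem J (f := (torsionPart J M).subtype) Subtype.val_injective x.2

lemma torsionPart_eq_top_of_surjective {f : M →ₗ[A] N} (hf : Function.Surjective f)
    (hM : torsionPart J M = ⊤) : torsionPart J N = ⊤ := by
  refine eq_top_iff.2 fun y _ => ?_
  obtain ⟨x, rfl⟩ := hf y
  exact map_mem_torsionPart J f (hM ▸ Submodule.mem_top)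

lemma exists_pow_le_annihilator [Module.Finite A M] (hM : torsionPart J M = ⊤) :
    ∃ n, J ^ n ≤ Module.annihilator A M := by
  obtain ⟨s, hs⟩ := Module.Finite.fg_top (R := A) (M := M)
  have h : ∀ x : M, ∃ n, ∀ r ∈ J ^ n, r • x = 0 := fun x => by
    rw [← mem_torsionPart, hM]; trivial
  choose n hn using h
  refine ⟨s.sup n, fun r hr => ?_⟩
  rw [Module.mem_annihilator]
  intro x
  have hx : x ∈ Submodule.span A (s : Set M) := by rw [hs]; trivial
  induction hx using Submodule.span_induction with
  | mem x hx => exact hn x r (Ideal.pow_le_pow_right (Finset.le_sup hx) hr)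
  | zero => simp
  | add x y _ _ hx hy => rw [smul_add, hx, hy, add_zero]
  | smul a x _ hx => rw [smul_comm, hx, smul_zero]

instance injective_torsionPart [IsNoetherianRing A] [Module.Injective A M] :
    Module.Injective A (torsionPart J M) := by
  refine Module.Baer.injective fun I f => ?_
  obtain ⟨n, hn⟩ : ∃ n, J ^ n ≤ Module.annihilator A (LinearMap.range f) := by
    apply exists_pow_le_annihilator
    refine eq_top_iff.2 fun x _ => mem_torsionPart_of_map_mem J
      (f := (torsionPart J M).subtype ∘ₗ (LinearMap.range f).subtype) ?_ x.1.2
    exact Subtype.val_injective.comp Subtype.val_injective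
  obtain ⟨k, hk⟩ := Ideal.exists_pow_inf_eq_pow_smul J (M := A) I
  let p : I →ₗ[A] A ⧸ J ^ (n + k) := (Submodule.mkQ (J ^ (n + k))) ∘ₗ I.subtype
  have hp : LinearMap.ker p ≤ LinearMap.ker ((torsionPart J M).subtype ∘ₗ f) := by
    rintro ⟨x, hxI⟩ hx
    replace hx : x ∈ J ^ (n + k) := (Submodule.Quotient.mk_eq_zero _).1 hx
    have h₁ : x ∈ J ^ (n + k) • (⊤ : Submodule A A) ⊓ I := ⟨by simpa using hx, hxI⟩
    rw [hk _ (by omega), Nat.add_sub_cancel] at h₁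
    have h₂ : x ∈ J ^ n • I := Submodule.smul_mono le_rfl inf_le_right h₁
    rw [LinearMap.mem_ker, LinearMap.comp_apply, Submodule.subtype_apply, ZeroMemClass.coe_eq_zero]
    have key : J ^ n • I ≤ (LinearMap.ker f).map I.subtype := by
      refine Submodule.smul_le.2 fun r hr z hz => ⟨r • ⟨z, hz⟩, ?_, rfl⟩
      rw [SetLike.mem_coe, LinearMap.mem_ker, map_smul]
      have := Module.mem_annihilator.1 (hn hr) ⟨f ⟨z, hz⟩, LinearMap.mem_range_self _ _⟩
      exact congrArg Subtype.val this
    obtain ⟨z, hz, rfl⟩ := key h₂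
    exact hz
  obtain ⟨h, hh⟩ := Module.Injective.out ((LinearMap.ker p).liftQ p le_rfl)
    (LinearMap.ker_eq_bot.1 (Submodule.ker_liftQ_eq_bot _ _ _ le_rfl))
    ((LinearMap.ker p).liftQ ((torsionPart J M).subtype ∘ₗ f) hp)
  have hmem : h (Submodule.Quotient.mk 1) ∈ torsionPart J M := by
    refine ⟨n + k, fun r hr => ?_⟩
    rw [← map_smul, ← Submodule.Quotient.mk_smul, smul_eq_mul, mul_one,
      (Submodule.Quotient.mk_eq_zero _).2 hr, map_zero]
  refine ⟨LinearMap.toSpanSingleton A _ ⟨_, hmem⟩, fun x hx => Subtype.ext ?_⟩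
  have := hh (Submodule.Quotient.mk ⟨x, hx⟩)
  refine Eq.trans ?_ this
  change x • h (Submodule.Quotient.mk 1) = h (Submodule.Quotient.mk x)
  rw [← map_smul, ← Submodule.Quotient.mk_smul, smul_eq_mul, mul_one]

lemma exists_injective_into_injective (M : Type u) [AddCommGroup M] [Module A M] :
    ∃ (E : Type u) (_ : AddCommGroup E) (_ : Module A E) (_ : Module.Injective A E)
      (f : M →ₗ[A] E), Function.Injective f := by
  let E : ModuleCat.{u} A := Injective.under (ModuleCat.of A M)
  have hE : Injective E := inferInstanceAs (Injective (Injective.under (ModuleCat.of A M)))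
  have : Injective (ModuleCat.of A E) := hE
  let f : ModuleCat.of A M ⟶ E := Injective.ι (ModuleCat.of A M)
  have hf : Mono f := inferInstanceAs (Mono (Injective.ι (ModuleCat.of A M)))
  exact ⟨E, inferInstance, inferInstance, Module.injective_module_of_injective_object A E,
    f.hom, (ModuleCat.mono_iff_injective f).1 hf⟩

lemma LC_succ_eq_zero_of_torsion [IsNoetherianRing A] (i : ℕ) (hM : torsionPart J M = ⊤)
    (x : LC J (i + 1) M) : x = 0 := by
  induction i generalizing M with
  | zero =>
    obtain ⟨E, _, _, _, f, hf⟩ := exists_injective_into_injective (A := A) M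
    let f' : M →ₗ[A] torsionPart J E :=
      f.codRestrict _ fun x => map_mem_torsionPart J f (hM ▸ Submodule.mem_top)
    have hf' : Function.Injective f' := fun x y h => hf (congrArg Subtype.val h)
    obtain ⟨δ, h₁, h₂⟩ := exists_connecting J 0 hf' (LinearMap.exact_map_mkQ_range f')
      (Submodule.mkQ_surjective _)
    obtain ⟨y, rfl⟩ := (h₂ x).1 (LC_succ_eq_zero_of_injective J 0 _)
    obtain ⟨z, rfl⟩ := LCmap_zero_surjective J (torsionPart_torsionPart J) _
      (Submodule.mkQ_surjective (LinearMap.range f')) y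
    exact h₁.apply_apply_eq_zero z
  | succ i ih =>
    obtain ⟨E, _, _, _, f, hf⟩ := exists_injective_into_injective (A := A) M
    let f' : M →ₗ[A] torsionPart J E :=
      f.codRestrict _ fun x => map_mem_torsionPart J f (hM ▸ Submodule.mem_top)
    have hf' : Function.Injective f' := fun x y h => hf (congrArg Subtype.val h)
    obtain ⟨δ, h₁, h₂⟩ := exists_connecting J (i + 1) hf' (LinearMap.exact_map_mkQ_range f')
      (Submodule.mkQ_surjective _)
    obtain ⟨y, rfl⟩ := (h₂ x).1 (LC_succ_eq_zero_of_injective J (i + 1) _)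
    rw [ih (torsionPart_eq_top_of_surjective J (Submodule.mkQ_surjective (LinearMap.range f'))
      (torsionPart_torsionPart J)) y, map_zero]

end Modules

end Torsion

open IsLocalRing

section Artinian

variable {A N : Type*} [CommRing A] [AddCommGroup N] [Module A N]

/-- An `a`-power torsion module whose `a`-torsion is Artinian is Artinian. -/
theorem isArtinian_of_isArtinian_ker_lsmul (a : A) (ha : ∀ x : N, ∃ k, a ^ k • x = 0)
    [IsArtinian A (LinearMap.ker (LinearMap.lsmul A N a))] : IsArtinian A N := by
  rw [← monotone_stabilizes_iff_artinian]
  intro F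
  have hF : ∀ {i j}, i ≤ j → ∀ {x}, x ∈ OrderDual.ofDual (F j) → x ∈ OrderDual.ofDual (F i) :=
    fun h _ hx => F.monotone h hx
  let E (j k : ℕ) : Submodule A (LinearMap.ker (LinearMap.lsmul A N a)) :=
    ((OrderDual.ofDual (F j) ⊓ LinearMap.ker (LinearMap.lsmul A N (a ^ (k + 1)))).map
      (LinearMap.lsmul A N (a ^ k))).comap (Submodule.subtype _)
  have hE {j k : ℕ} (y : LinearMap.ker (LinearMap.lsmul A N a)) :
      y ∈ E j k ↔ ∃ x ∈ OrderDual.ofDual (F j), a ^ k • x = y := by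
    have hy : a • (y : N) = 0 := y.2
    simp only [E, Submodule.mem_comap, Submodule.mem_map, Submodule.mem_inf, LinearMap.mem_ker,
      LinearMap.lsmul_apply, Submodule.subtype_apply]
    constructor
    · rintro ⟨x, hx, h⟩
      exact ⟨x, hx.1, h⟩
    · rintro ⟨x, hx, h⟩
      exact ⟨x, ⟨hx, by rw [pow_succ', mul_smul, h, hy]⟩, h⟩
  have anti {j j' k k' : ℕ} (hj : j ≤ j') (hk : k ≤ k') : E j' k' ≤ E j k := by
    intro y hy
    rw [hE] at hy ⊢
    obtain ⟨x, hx, h⟩ := hy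
    exact ⟨a ^ (k' - k) • x, Submodule.smul_mem _ _ (hF hj hx), by
      rw [smul_smul, ← pow_add, Nat.add_sub_cancel' hk, h]⟩
  obtain ⟨n, hn⟩ := IsArtinian.monotone_stabilizes
    (⟨fun j => OrderDual.toDual (E j j), fun _ _ h => anti h h⟩ : ℕ →o (Submodule A _)ᵒᵈ)
  have hrow : ∀ k, ∃ m, ∀ j, m ≤ j → E m k = E j k := fun k =>
    IsArtinian.monotone_stabilizes
      (⟨fun j => OrderDual.toDual (E j k), fun _ _ h => anti h le_rfl⟩ : ℕ →o (Submodule A _)ᵒᵈ)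
  choose m hm using hrow
  let J := n + (Finset.range n).sup m
  have hJ (j k : ℕ) (hj : J ≤ j) : E J k ≤ E j k := by
    by_cases hk : k < n
    · have h₁ : m k ≤ J := (Finset.le_sup (Finset.mem_range.2 hk)).trans (Nat.le_add_left _ _)
      rw [← hm k J h₁, ← hm k j (h₁.trans hj)]
    · push Not at hk
      have h₁ : n ≤ J := Nat.le_add_right _ _
      calc E J k ≤ E n n := anti h₁ hk
        _ = E (j + k) (j + k) := hn (j + k) (by omega)
        _ ≤ E j k := anti (by omega) (by omega)
  refine ⟨J, fun j hj => le_antisymm (F.monotone hj) fun x hx => ?_⟩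
  obtain ⟨k, hk⟩ := ha x
  induction k generalizing x with
  | zero =>
    rw [pow_zero, one_smul] at hk
    exact hk ▸ Submodule.zero_mem _
  | succ k ih =>
    have hx' : a • a ^ k • x = 0 := by rw [smul_smul, ← pow_succ', hk]
    obtain ⟨y, hy, hxy⟩ := (hE _).1 (hJ j k hj ((hE ⟨a ^ k • x, hx'⟩).2 ⟨x, hx, rfl⟩))
    have := ih (x - y) (Submodule.sub_mem _ hx (hF hj hy)) (by rw [smul_sub, hxy, sub_self])
    simpa using Submodule.add_mem _ this hy

/-- Every element of `A` acts on `S` either surjectively or nilpotently. For `S ≠ ⊥` this says that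
`S` is secondary. -/
def IsSecondaryOrBot (S : Submodule A N) : Prop :=
  ∀ r : A, S ≤ S.map (LinearMap.lsmul A N r) ∨ ∃ k, ∀ x ∈ S, r ^ k • x = 0

lemma isSecondaryOrBot_of_supIrred [IsArtinian A N] {S : Submodule A N} (hS : SupIrred S) :
    IsSecondaryOrBot S := by
  intro r
  let F (k : ℕ) : Submodule A N := S.map (LinearMap.lsmul A N (r ^ k))
  have hF {k : ℕ} {y : N} : y ∈ F k ↔ ∃ x ∈ S, r ^ k • x = y := Iff.rfl
  have anti : ∀ {i j}, i ≤ j → F j ≤ F i := by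
    rintro i j hij _ ⟨x, hx, rfl⟩
    exact ⟨r ^ (j - i) • x, S.smul_mem _ hx, by
      simp [smul_smul, ← pow_add, Nat.sub_add_cancel hij]⟩
  obtain ⟨k, hk⟩ := IsArtinian.monotone_stabilizes
    (⟨fun j => OrderDual.toDual (F j), fun _ _ h => anti h⟩ : ℕ →o (Submodule A N)ᵒᵈ)
  replace hk : ∀ j, k ≤ j → F k = F j := hk
  have hsup : F k ⊔ (S ⊓ LinearMap.ker (LinearMap.lsmul A N (r ^ k))) = S := by
    apply le_antisymm
    · refine sup_le ?_ inf_le_left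
      rintro _ ⟨x, hx, rfl⟩
      exact S.smul_mem _ hx
    · intro x hx
      have h₁ : r ^ k • x ∈ F (k + k) := hk (k + k) (by omega) ▸ hF.2 ⟨x, hx, rfl⟩
      obtain ⟨y, hy, hyx⟩ := hF.1 h₁
      refine Submodule.mem_sup.2 ⟨r ^ k • y, ⟨y, hy, rfl⟩, x - r ^ k • y,
        ⟨S.sub_mem hx (S.smul_mem _ hy), ?_⟩, by simp⟩
      change r ^ k • (x - r ^ k • y) = 0
      rw [smul_sub, smul_smul, ← pow_add, hyx, sub_self]
  rcases hS.2 hsup with h | h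
  · left
    intro x hx
    rw [← h, hk (k + 1) (by omega)] at hx
    obtain ⟨y, hy, hyx⟩ := hF.1 hx
    exact ⟨r ^ k • y, S.smul_mem _ hy, by
      rw [LinearMap.lsmul_apply, smul_smul, ← pow_succ', hyx]⟩
  · right
    exact ⟨k, fun x hx => (h ▸ hx : x ∈ S ⊓ _).2⟩

lemma mem_radical_annihilator {S : Submodule A N} {r : A} :
    r ∈ (Module.annihilator A S).radical ↔ ∃ k, ∀ x ∈ S, r ^ k • x = 0 := by
  refine exists_congr fun k => ?_
  rw [Module.mem_annihilator]
  simp [Subtype.ext_iff]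

lemma isPrime_radical_annihilator [IsArtinian A N] {S : Submodule A N} (hS : SupIrred S) :
    (Module.annihilator A S).radical.IsPrime := by
  have hbot : S ≠ ⊥ := fun h => hS.1 (h ▸ isMin_bot)
  have surj_not {r : A} (h : S ≤ S.map (LinearMap.lsmul A N r)) :
      r ∉ (Module.annihilator A S).radical := by
    rw [mem_radical_annihilator]
    rintro ⟨k, hk⟩
    refine hbot (eq_bot_iff.2 fun x hx => ?_)
    induction k generalizing x with
    | zero => simpa using hk x hx
    | succ k ih =>
      refine ih (fun y hy => ?_) x hx
      obtain ⟨z, hz, rfl⟩ := h hy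
      simpa [smul_smul, ← pow_succ] using hk z hz
  have nmem {r : A} (h : r ∉ (Module.annihilator A S).radical) :
      S ≤ S.map (LinearMap.lsmul A N r) := by
    rw [mem_radical_annihilator] at h
    exact (isSecondaryOrBot_of_supIrred hS r).resolve_right h
  refine ⟨fun h => ?_, fun {r t} hrt => ?_⟩
  · exact surj_not (r := 1) (fun x hx => ⟨x, hx, by simp⟩) (h ▸ Submodule.mem_top)
  · by_contra! hcon
    refine surj_not (r := r * t) (fun x hx => ?_) hrt
    obtain ⟨y, hy, rfl⟩ := nmem hcon.1 hx
    obtain ⟨z, hz, rfl⟩ := nmem hcon.2 hy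
    exact ⟨z, hz, mul_smul r t z⟩

lemma isNoetherian_iff_isArtinian_of_pow_le_annihilator [IsLocalRing A] [IsNoetherianRing A]
    {n : ℕ} (h : maximalIdeal A ^ n ≤ Module.annihilator A N) :
    IsNoetherian A N ↔ IsArtinian A N := by
  let I := maximalIdeal A ^ (n + 1)
  have hI : I ≤ Module.annihilator A N := (Ideal.pow_le_pow_right n.le_succ).trans h
  have : IsArtinianRing (A ⧸ I) := by
    refine quotient_artinian_of_mem_minimalPrimes_of_isLocalRing I
      ⟨⟨inferInstance, Ideal.pow_le_self n.succ_ne_zero⟩, fun J hJ _ => ?_⟩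
    exact hJ.1.le_of_pow_le hJ.2
  have htors : Module.IsTorsionBySet A N (I : Set A) := fun x r =>
    Module.mem_annihilator.1 (hI r.2) x
  let _ := htors.module
  let e : N →ₛₗ[Ideal.Quotient.mk I] N := ⟨.id _, fun _ _ ↦ rfl⟩
  rw [e.isNoetherian_iff_of_bijective Function.bijective_id,
    e.isArtinian_iff_of_bijective Function.bijective_id]
  exact IsSemiprimaryRing.isNoetherian_iff_isArtinian

/-- If `N` is Artinian, then some `r` in the maximal ideal avoiding any given finite set of
non-maximal primes has `N ⧸ rN` finitely generated. -/
theorem exists_mem_maximalIdeal_finite_quotient [IsLocalRing A] [IsNoetherianRing A]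
    [IsArtinian A N] (Q : Finset (Ideal A)) (hQ : ∀ q ∈ Q, q.IsPrime ∧ q ≠ maximalIdeal A) :
    ∃ r ∈ maximalIdeal A, (∀ q ∈ Q, r ∉ q) ∧
      Module.Finite A (N ⧸ LinearMap.range (LinearMap.lsmul A N r)) := by
  classical
  obtain ⟨s, hs, hirr⟩ := exists_supIrred_decomposition (⊤ : Submodule A N)
  let p (S : Submodule A N) : Ideal A := (Module.annihilator A S).radical
  let t : Finset (Ideal A) := Q ∪ (s.image p).filter (· ≠ maximalIdeal A)
  have ht : ∀ q ∈ t, q.IsPrime ∧ q ≠ maximalIdeal A := by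
    intro q hq
    rcases Finset.mem_union.1 hq with h | h
    · exact hQ q h
    · obtain ⟨h₁, h₂⟩ := Finset.mem_filter.1 h
      obtain ⟨S, hS, rfl⟩ := Finset.mem_image.1 h₁
      exact ⟨isPrime_radical_annihilator (hirr hS), h₂⟩
  have hnot : ¬ ((maximalIdeal A : Set A) ⊆ ⋃ q ∈ (t : Set (Ideal A)), (q : Set A)) := by
    rw [Ideal.subset_union_prime (f := fun q : Ideal A => q) ⊥ ⊥ (fun q hq _ _ => (ht q hq).1)]
    rintro ⟨q, hq, hle⟩
    exact (ht q hq).2 (le_antisymm (le_maximalIdeal (ht q hq).1.ne_top) hle)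
  obtain ⟨r, hr, hrt⟩ := Set.not_subset.1 hnot
  simp only [Set.mem_iUnion, not_exists] at hrt
  refine ⟨r, hr, fun q hq h => hrt q (Finset.mem_union_left _ hq) h, ?_⟩
  have hmap : ∀ S ∈ s, (S.map (Submodule.mkQ (LinearMap.range (LinearMap.lsmul A N r)))).FG := by
    intro S hS
    by_cases hp : p S = maximalIdeal A
    · obtain ⟨n, hn⟩ := Ideal.exists_pow_le_of_le_radical_of_fg hp.ge
        (IsNoetherian.noetherian (maximalIdeal A))
      have := (isNoetherian_iff_isArtinian_of_pow_le_annihilator hn).2 inferInstance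
      exact Submodule.FG.map _ ((Submodule.fg_top _).1 (IsNoetherian.noetherian _))
    · have hrS : r ∉ p S := hrt _ (Finset.mem_union_right _
        (Finset.mem_filter.2 ⟨Finset.mem_image_of_mem _ hS, hp⟩))
      have : S.map (Submodule.mkQ (LinearMap.range (LinearMap.lsmul A N r))) = ⊥ := by
        rw [eq_bot_iff]
        rintro _ ⟨x, hx, rfl⟩
        obtain ⟨y, -, rfl⟩ := ((isSecondaryOrBot_of_supIrred (hirr hS) r).resolve_right
          (fun h => hrS (mem_radical_annihilator.2 h))) hx
        exact (Submodule.Quotient.mk_eq_zero _).2 ⟨y, rfl⟩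
      rw [this]
      exact Submodule.fg_bot
  have htop : (⊤ : Submodule A (N ⧸ LinearMap.range (LinearMap.lsmul A N r))) =
      s.sup fun S => S.map (Submodule.mkQ (LinearMap.range (LinearMap.lsmul A N r))) := by
    generalize LinearMap.range (LinearMap.lsmul A N r) = P
    calc (⊤ : Submodule A (N ⧸ P)) = (s.sup id).map P.mkQ := by
          rw [hs, Submodule.map_top, Submodule.range_mkQ]
      _ = s.sup fun S => S.map P.mkQ :=
          Finset.apply_sup_eq_sup_comp (Submodule.map P.mkQ)
            (fun a b => Submodule.map_sup _ _ _) (Submodule.map_bot _)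
  exact ⟨htop ▸ Submodule.fg_finset_sup s _ hmap⟩

end Artinian

open IsLocalRing Pointwise

section TorsionQuotient

variable {A : Type u} [CommRing A] [IsNoetherianRing A] (J : Ideal A)
  (M : Type u) [AddCommGroup M] [Module A M]

lemma torsionPart_quotient_torsionPart [Module.Finite A M] :
    torsionPart J (M ⧸ torsionPart J M) = ⊥ := by
  refine eq_bot_iff.2 fun y hy => ?_
  obtain ⟨x, rfl⟩ := Submodule.mkQ_surjective _ y
  obtain ⟨n, hn⟩ := hy
  obtain ⟨k, hk⟩ := exists_pow_le_annihilator J (torsionPart_torsionPart J (M := M))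
  refine (Submodule.Quotient.mk_eq_zero _).2 ⟨k + n, fun r hr => ?_⟩
  rw [pow_add] at hr
  refine Submodule.mul_induction_on hr (fun s hs t ht => ?_) fun s t hs ht => ?_
  · have h : t • x ∈ torsionPart J M := (Submodule.Quotient.mk_eq_zero _).1 (hn t ht)
    rw [mul_smul]
    exact congrArg Subtype.val (Module.mem_annihilator.1 (hk hs) ⟨t • x, h⟩)
  · rw [add_smul, hs, ht, add_zero]

lemma LCmap_mkQ_torsionPart_bijective (i : ℕ) :
    Function.Bijective (LCmap J (i + 1) (torsionPart J M).mkQ) := by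
  have hzero (i : ℕ) (x : LC J (i + 1) (torsionPart J M)) : x = 0 :=
    LC_succ_eq_zero_of_torsion J i (torsionPart_torsionPart J) x
  have hex := LinearMap.exact_subtype_mkQ (torsionPart J M)
  have hinj := (torsionPart J M).injective_subtype
  have hsurj := (torsionPart J M).mkQ_surjective
  constructor
  · rw [injective_iff_map_eq_zero]
    intro x hx
    obtain ⟨y, rfl⟩ := (LCmap_exact J (i + 1) hinj hex hsurj x).1 hx
    rw [hzero i y, map_zero]
  · intro y
    obtain ⟨δ, hδ, -⟩ := exists_connecting J (i + 1) hinj hex hsurj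
    exact (hδ y).1 (hzero (i + 1) _)

end TorsionQuotient

section Regular

variable {A : Type u} [CommRing A] (J : Ideal A) {M : Type u} [AddCommGroup M] [Module A M]
  {a : A}

variable {J} in
lemma subsingleton_LC_zero (hM : torsionPart J M = ⊥) : Subsingleton (LC J 0 M) :=
  have : Subsingleton (torsionPart J M) := by rw [hM]; infer_instance
  (LCZeroEquiv J).injective.subsingleton

lemma exact_smul_mkQ : Function.Exact (a • (LinearMap.id : M →ₗ[A] M))
    (Submodule.mkQ (a • (⊤ : Submodule A M))) := by
  intro x
  rw [Submodule.mkQ_apply, Submodule.Quotient.mk_eq_zero, Submodule.mem_smul_pointwise_iff_exists]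
  simp

/-- The two exact pieces of the long exact sequence attached to `0 → M → M → M ⧸ aM → 0`. -/
lemma exists_connecting_of_isSMulRegular (i : ℕ) (ha : IsSMulRegular M a) :
    ∃ (g : LC J i M →ₗ[A] LC J i (QuotSMulTop a M))
      (δ : LC J i (QuotSMulTop a M) →ₗ[A] LC J (i + 1) M),
      Function.Exact (LinearMap.lsmul A (LC J i M) a) g ∧ Function.Exact g δ ∧
        Function.Exact δ (LinearMap.lsmul A (LC J (i + 1) M) a) := by
  have hinj : Function.Injective (a • (LinearMap.id : M →ₗ[A] M)) := ha
  have hsurj := (a • (⊤ : Submodule A M)).mkQ_surjective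
  have hmap (i : ℕ) : LCmap J i (a • (LinearMap.id : M →ₗ[A] M)) = LinearMap.lsmul A (LC J i M) a :=
    LinearMap.ext fun x => LCmap_smul_id J i a x
  obtain ⟨δ, h₁, h₂⟩ := exists_connecting J i hinj exact_smul_mkQ hsurj
  have h₀ := LCmap_exact J i hinj exact_smul_mkQ hsurj
  rw [hmap] at h₀ h₂
  exact ⟨_, δ, h₀, h₁, h₂⟩

variable [IsNoetherianRing A]

lemma isSMulRegular_of_forall_notMem (h : ∀ p ∈ associatedPrimes A M, a ∉ p) :
    IsSMulRegular M a := by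
  have hmem : a ∉ ⋃ p ∈ associatedPrimes A M, (p : Set A) := by simpa using h
  rw [biUnion_associatedPrimes_eq_compl_regular] at hmem
  simpa using hmem

variable [IsLocalRing A]

lemma maximalIdeal_notMem_associatedPrimes (hM : torsionPart (maximalIdeal A) M = ⊥) :
    maximalIdeal A ∉ associatedPrimes A M := by
  intro h
  obtain ⟨hp, x, hx⟩ := isAssociatedPrime_iff.1 h
  have hmem : x ∈ torsionPart (maximalIdeal A) M := ⟨1, fun r hr => by
    rw [pow_one, hx] at hr
    simpa using hr⟩
  rw [hM, Submodule.mem_bot] at hmem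
  subst hmem
  refine hp.ne_top (hx.trans ?_)
  simp

/-- If `H` is Artinian and `M` has no `𝔪`-torsion, some `M`-regular element `r` of `𝔪` has
`H ⧸ rH` finitely generated. -/
lemma exists_isSMulRegular_finite_quotient [Module.Finite A M]
    (hM : torsionPart (maximalIdeal A) M = ⊥) (H : Type u) [AddCommGroup H] [Module A H]
    [IsArtinian A H] :
    ∃ r ∈ maximalIdeal A, IsSMulRegular M r ∧
      Module.Finite A (H ⧸ LinearMap.range (LinearMap.lsmul A H r)) := by
  obtain ⟨r, hr, hreg, hfin⟩ := exists_mem_maximalIdeal_finite_quotient (A := A) (N := H)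
    (associatedPrimes.finite A M).toFinset fun q hq => by
      rw [Set.Finite.mem_toFinset] at hq
      exact ⟨hq.1, fun h => maximalIdeal_notMem_associatedPrimes hM (h ▸ hq)⟩
  exact ⟨r, hr, isSMulRegular_of_forall_notMem fun p hp =>
    hreg p ((Set.Finite.mem_toFinset _).2 hp), hfin⟩

theorem isArtinian_LC (i : ℕ) (M : Type u) [AddCommGroup M] [Module A M] [Module.Finite A M] :
    IsArtinian A (LC (maximalIdeal A) i M) := by
  induction i generalizing M with
  | zero =>
    obtain ⟨n, hn⟩ := exists_pow_le_annihilator (maximalIdeal A)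
      (torsionPart_torsionPart (maximalIdeal A) (M := M))
    have := (isNoetherian_iff_isArtinian_of_pow_le_annihilator hn).1 inferInstance
    exact isArtinian_of_injective (LCZeroEquiv (maximalIdeal A)).toLinearMap
      (LCZeroEquiv (maximalIdeal A)).injective
  | succ i ih =>
    suffices h : ∀ (M : Type u) [AddCommGroup M] [Module A M] [Module.Finite A M],
        torsionPart (maximalIdeal A) M = ⊥ → IsArtinian A (LC (maximalIdeal A) (i + 1) M) by
      have := h (M ⧸ torsionPart (maximalIdeal A) M) (torsionPart_quotient_torsionPart _ M)
      exact isArtinian_of_injective _ (LCmap_mkQ_torsionPart_bijective (maximalIdeal A) M i).1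
    intro M _ _ _ hM
    obtain ⟨a, ha, hreg, -⟩ := exists_isSMulRegular_finite_quotient hM PUnit.{u + 1}
    obtain ⟨-, δ, -, -, hδ⟩ := exists_connecting_of_isSMulRegular (maximalIdeal A) i hreg
    have := ih (QuotSMulTop a M)
    rw [LinearMap.exact_iff] at hδ
    have : IsArtinian A (LinearMap.ker (LinearMap.lsmul A (LC (maximalIdeal A) (i + 1) M) a)) := by
      rw [hδ]
      exact isArtinian_of_surjective _ δ.rangeRestrict δ.surjective_rangeRestrict
    refine isArtinian_of_isArtinian_ker_lsmul a fun x => ?_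
    obtain ⟨k, hk⟩ := exists_pow_smul_eq_zero (maximalIdeal A) _ x
    exact ⟨k, hk _ (Ideal.pow_mem_pow ha k)⟩

end Regular

section Dimension

variable {A : Type u} [CommRing A] [IsLocalRing A]
  (M : Type u) [AddCommGroup M] [Module A M] [Module.Finite A M]

lemma support_subset_of_torsionPart_eq_top (h : torsionPart (maximalIdeal A) M = ⊤) :
    Module.support A M ⊆ {closedPoint A} := by
  obtain ⟨n, hn⟩ := exists_pow_le_annihilator _ h
  intro p hp
  refine PrimeSpectrum.ext (le_antisymm (le_maximalIdeal p.2.ne_top) ?_)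
  exact p.2.le_of_pow_le (hn.trans (Module.annihilator_le_of_mem_support hp))

variable [IsNoetherianRing A]

lemma torsionPart_eq_top_of_supportDim_eq_zero (h : Module.supportDim A M = 0) :
    torsionPart (maximalIdeal A) M = ⊤ := by
  have hs := support_of_supportDim_eq_zero A M h
  rw [Module.support_eq_zeroLocus] at hs
  obtain ⟨n, hn⟩ := Ideal.exists_pow_le_of_le_radical_of_fg
    ((PrimeSpectrum.zeroLocus_subset_zeroLocus_iff _ _).1 hs.le)
    (IsNoetherian.noetherian (maximalIdeal A))
  exact eq_top_iff.2 fun x _ => ⟨n, fun r hr => Module.mem_annihilator.1 (hn hr) x⟩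

lemma supportDim_quotient_torsionPart {d : ℕ} (h : Module.supportDim A M = (d + 1 : ℕ)) :
    Module.supportDim A (M ⧸ torsionPart (maximalIdeal A) M) = (d + 1 : ℕ) := by
  let Γ := torsionPart (maximalIdeal A) M
  have hΓ : Nontrivial (M ⧸ Γ) := by
    rw [Submodule.Quotient.nontrivial_iff]
    intro htop
    have hsub : Subsingleton (Module.support A M) :=
      (Set.subsingleton_singleton.anti (support_subset_of_torsionPart_eq_top M htop)).coe_sort
    have : Module.supportDim A M ≤ 0 := Order.krullDim_nonpos_of_subsingleton
    rw [h] at this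
    norm_cast at this
  have hsupp := Module.support_of_exact (LinearMap.exact_subtype_mkQ Γ) Γ.injective_subtype
    Γ.mkQ_surjective
  rw [Set.union_eq_right.2] at hsupp
  · rw [← h, Module.supportDim, Module.supportDim, hsupp]
  · refine (support_subset_of_torsionPart_eq_top Γ (torsionPart_torsionPart _)).trans ?_
    rw [Set.singleton_subset_iff]
    exact closedPoint_mem_support A (M ⧸ Γ)

lemma supportDim_quotSMulTop {d : ℕ} {r : A} (hr : r ∈ maximalIdeal A) (hreg : IsSMulRegular M r)
    (h : Module.supportDim A M = (d + 1 : ℕ)) : Module.supportDim A (QuotSMulTop r M) = d := by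
  have := Module.supportDim_quotSMulTop_succ_eq_supportDim hreg hr
  rw [h] at this
  exact ENat.WithBot.add_one_cancel.1 (this.trans (by norm_cast))

theorem not_finite_LC (d : ℕ) (h : Module.supportDim A M = (d + 1 : ℕ)) :
    ¬ Module.Finite A (LC (maximalIdeal A) (d + 1) M) := by
  induction d generalizing M with
  | zero =>
    suffices hfree : ∀ (M : Type u) [AddCommGroup M] [Module A M] [Module.Finite A M],
        Module.supportDim A M = (0 + 1 : ℕ) → torsionPart (maximalIdeal A) M = ⊥ →
          ¬ Module.Finite A (LC (maximalIdeal A) (0 + 1) M) by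
      intro hfin
      exact hfree _ (supportDim_quotient_torsionPart M h) (torsionPart_quotient_torsionPart _ M)
        (Module.Finite.of_surjective _ (LCmap_mkQ_torsionPart_bijective (maximalIdeal A) M 0).2)
    intro M _ _ _ h hM hfin
    obtain ⟨r, hr, hreg, -⟩ := exists_isSMulRegular_finite_quotient hM PUnit.{u + 1}
    obtain ⟨k, hk⟩ := exists_pow_le_annihilator (maximalIdeal A)
      (M := LC (maximalIdeal A) (0 + 1) M)
      (eq_top_iff.2 fun x _ => exists_pow_smul_eq_zero (maximalIdeal A) _ x)
    have hreg' : IsSMulRegular M (r ^ (k + 1)) := hreg.pow _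
    have hr' : r ^ (k + 1) ∈ maximalIdeal A := Ideal.pow_mem_of_mem _ hr _ k.succ_pos
    obtain ⟨g, δ, -, hδ, -⟩ := exists_connecting_of_isSMulRegular (maximalIdeal A) 0 hreg'
    have := subsingleton_LC_zero hM
    have hinj : Function.Injective δ := by
      rw [injective_iff_map_eq_zero]
      intro x hx
      obtain ⟨y, rfl⟩ := (hδ x).1 hx
      rw [Subsingleton.elim y 0, map_zero]
    have htop := torsionPart_eq_top_of_supportDim_eq_zero (QuotSMulTop (r ^ (k + 1)) M)
      (supportDim_quotSMulTop M hr' hreg' h)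
    have hkill (y : QuotSMulTop (r ^ (k + 1)) M) : r ^ k • y = 0 := by
      have hy : y ∈ torsionPart (maximalIdeal A) (QuotSMulTop (r ^ (k + 1)) M) :=
        htop ▸ Submodule.mem_top
      have h₀ (z : LC (maximalIdeal A) 0 (QuotSMulTop (r ^ (k + 1)) M)) : r ^ k • z = 0 := by
        apply hinj
        rw [map_smul, map_zero]
        exact Module.mem_annihilator.1 (hk (Ideal.pow_mem_pow hr k)) _
      have h₁ := h₀ ((LCZeroEquiv (maximalIdeal A)).symm ⟨y, hy⟩)
      rw [← map_smul, LinearEquiv.map_eq_zero_iff] at h₁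
      exact congrArg Subtype.val h₁
    have hle : (⊤ : Submodule A M) ≤ maximalIdeal A • ⊤ := by
      intro x _
      have hx : Submodule.mkQ (r ^ (k + 1) • (⊤ : Submodule A M)) (r ^ k • x) = 0 := by
        rw [map_smul]
        exact hkill _
      obtain ⟨y, -, hy⟩ := (Submodule.mem_smul_pointwise_iff_exists _ _ _).1
        ((Submodule.Quotient.mk_eq_zero _).1 hx)
      have : r • y = x := hreg.pow k (by
        change r ^ k • r • y = r ^ k • x
        rw [smul_smul, ← pow_succ, hy])
      exact this ▸ Submodule.smul_mem_smul hr Submodule.mem_top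
    have hbot := Submodule.eq_bot_of_le_smul_of_le_jacobson_bot _ _
      (Module.Finite.fg_top (R := A) (M := M)) hle (maximalIdeal_le_jacobson _)
    have : Subsingleton M := (Submodule.subsingleton_iff A (M := M)).1
      (subsingleton_of_bot_eq_top hbot.symm)
    rw [Module.supportDim_eq_bot_of_subsingleton] at h
    exact WithBot.bot_ne_coe h
  | succ d ih =>
    suffices hfree : ∀ (M : Type u) [AddCommGroup M] [Module A M] [Module.Finite A M],
        Module.supportDim A M = (d + 1 + 1 : ℕ) → torsionPart (maximalIdeal A) M = ⊥ →
          ¬ Module.Finite A (LC (maximalIdeal A) (d + 1 + 1) M) by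
      intro hfin
      exact hfree _ (supportDim_quotient_torsionPart M h) (torsionPart_quotient_torsionPart _ M)
        (Module.Finite.of_surjective _
          (LCmap_mkQ_torsionPart_bijective (maximalIdeal A) M (d + 1)).2)
    intro M _ _ _ h hM hfin
    have := isArtinian_LC (A := A) (d + 1) M
    obtain ⟨r, hr, hreg, hquot⟩ :=
      exists_isSMulRegular_finite_quotient hM (LC (maximalIdeal A) (d + 1) M)
    obtain ⟨g, δ, hg, hδ, -⟩ := exists_connecting_of_isSMulRegular (maximalIdeal A) (d + 1) hreg
    refine ih (QuotSMulTop r M) (supportDim_quotSMulTop M hr hreg h) ?_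
    have := isNoetherian_of_isNoetherianRing_of_finite A (LC (maximalIdeal A) (d + 1 + 1) M)
    have := isNoetherian_of_isNoetherianRing_of_finite A (LC (maximalIdeal A) (d + 1) M ⧸
      LinearMap.range (LinearMap.lsmul A (LC (maximalIdeal A) (d + 1) M) r))
    rw [LinearMap.exact_iff] at hg hδ
    have := isNoetherian_of_range_eq_ker (Submodule.liftQ _ g hg.ge) δ
      (by rw [Submodule.range_liftQ, hδ])
    infer_instance

/-- The local cohomology of a nonzero finitely generated module in degree its dimension. -/
theorem nontrivial_LC_and_not_finite_LC (d : ℕ) (h : Module.supportDim A M = d) :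
    Nontrivial (LC (maximalIdeal A) d M) ∧
      (0 < d → ¬ Module.Finite A (LC (maximalIdeal A) d M)) := by
  cases d with
  | zero =>
    refine ⟨?_, fun h => absurd h (lt_irrefl _)⟩
    have : Nontrivial M := by
      rw [← Module.supportDim_ne_bot_iff_nontrivial A, h]
      exact WithBot.coe_ne_bot
    have : Nontrivial (torsionPart (maximalIdeal A) M) := by
      rw [torsionPart_eq_top_of_supportDim_eq_zero M h]
      exact Submodule.topEquiv.toEquiv.nontrivial
    exact (LCZeroEquiv (maximalIdeal A)).toEquiv.nontrivial
  | succ d =>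
    have hfin := not_finite_LC M d h
    refine ⟨not_subsingleton_iff_nontrivial.1 fun _ => hfin inferInstance, fun _ => hfin⟩

end Dimension

end LocalCohomologyAux

/-- **Grothendieck nonvanishing.** For a Noetherian local ring `(A, 𝔪)` and a nonzero finitely
generated `A`-module `M` of Krull dimension `d`, the local cohomology `H^d_𝔪(M)` is nonzero;
moreover if `d > 0` then `H^d_𝔪(M)` is not a finitely generated `A`-module. -/
theorem grothendieck_nonvanishing
    (A : Type) [CommRing A] [IsNoetherianRing A] [IsLocalRing A]
    (M : Type) [AddCommGroup M] [Module A M] [Module.Finite A M] [Nontrivial M]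
    (d : ℕ) (hd : (d : WithBot ℕ∞) = ringKrullDim (A ⧸ Module.annihilator A M)) :
    Nontrivial ((localCohomology (IsLocalRing.maximalIdeal A) d).obj (ModuleCat.of A M)) ∧
      (0 < d →
        ¬ Module.Finite A
          ((localCohomology (IsLocalRing.maximalIdeal A) d).obj (ModuleCat.of A M))) := by
  have e := LocalCohomologyAux.equivLocalCohomology (IsLocalRing.maximalIdeal A) d
    (ModuleCat.of A M)
  obtain ⟨hnontriv, hfin⟩ := LocalCohomologyAux.nontrivial_LC_and_not_finite_LC (A := A) M d
    ((Module.supportDim_eq_ringKrullDim_quotient_annihilator A M).trans hd.symm)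
  exact ⟨e.symm.toEquiv.nontrivial, fun h hf => hfin h (Module.Finite.equiv e.symm)⟩
end
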